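/- arXiv:2201.04372 — 4 statements merged into one kernel-verified Lean document; each statement's English description precedes it below -/
import Mathlib

section
/- Let p ≠ 3 be a prime and a, b, c integers with p ∤ abc. Then the quotient set R(C) of C(x,y,z) = a x^3 + b y^3 + c z^3 is dense in Q_p. -/
/-- In `ZMod p` with `p ≡ 2 [MOD 3]` every element is a cube. -/
theorem exists_cube_eq_of_mod_three_eq_two {p m : ℕ} [Fact p.Prime] (hp : p = 3 * m + 2)
    (u : ZMod p) : ∃ y : ZMod p, y ^ 3 = u := by
  refine ⟨u ^ (2 * m + 1), ?_⟩
  rcases eq_or_ne u 0 with rfl | hu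
  · simp
  have h := ZMod.pow_card_sub_one_eq_one hu
  rw [show p - 1 = 3 * m + 1 by omega] at h
  calc (u ^ (2 * m + 1)) ^ 3 = (u ^ (3 * m + 1)) ^ 2 * u := by ring
    _ = u := by rw [h]; ring

/-- In `ZMod p` with `p = 3 * k + 1`, an element with `k`-th power `1` is a cube. -/
theorem exists_cube_eq_of_pow_eq_one {p k : ℕ} [Fact p.Prime] (hp : p = 3 * k + 1)
    {u : ZMod p} (hu : u ^ k = 1) : ∃ y : ZMod p, y ^ 3 = u := by
  have hk : 0 < k := by
    have := (Fact.out : p.Prime).two_le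
    omega
  have hu0 : u ≠ 0 := by
    rintro rfl
    simp [hk.ne'] at hu
  obtain ⟨g, hgen⟩ := IsCyclic.exists_generator (α := (ZMod p)ˣ)
  have hg := orderOf_eq_card_of_forall_mem_zpowers hgen
  have hcard : Nat.card (ZMod p)ˣ = 3 * k := by
    rw [Nat.card_eq_fintype_card, ZMod.card_units_eq_totient,
      Nat.totient_prime (Fact.out : p.Prime)]
    omega
  have hmem : Units.mk0 u hu0 ∈ Submonoid.powers g := by
    rw [mem_powers_iff_mem_zpowers]
    exact hgen _
  obtain ⟨m, hm⟩ := hmem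
  have h1 : g ^ (m * k) = 1 := by
    rw [pow_mul]
    ext
    simp only at hm
    rw [hm]
    simpa using hu
  have h2 : 3 * k ∣ m * k := by
    rw [← hcard, ← hg]
    exact orderOf_dvd_of_pow_eq_one h1
  obtain ⟨j, rfl⟩ := Nat.dvd_of_mul_dvd_mul_right hk h2
  refine ⟨((g ^ j : (ZMod p)ˣ) : ZMod p), ?_⟩
  have := congrArg (Units.val) hm
  simp only [Units.val_mk0] at this
  rw [← this, ← Units.val_pow_eq_pow_val, ← pow_mul, mul_comm]

/-- Some `t` has none of `t`, `t + 1` and `1 + t⁻¹` a nonzero cube. -/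
theorem exists_pow_ne_one {p k : ℕ} [Fact p.Prime] (hp : p = 3 * k + 1) :
    ∃ t : ZMod p, t ^ k ≠ 1 ∧ (t + 1) ^ k ≠ 1 ∧ (1 + t⁻¹) ^ k ≠ 1 := by
  classical
  have hk : 0 < k := by
    have := (Fact.out : p.Prime).two_le
    omega
  set K : Finset (ZMod p) := Polynomial.nthRootsFinset k (1 : ZMod p) with hK
  have hmem (x : ZMod p) : x ∈ K ↔ x ^ k = 1 := Polynomial.mem_nthRootsFinset hk 1
  have hKcard : K.card ≤ k := by
    rw [hK, Polynomial.nthRootsFinset_def]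
    exact (Multiset.toFinset_card_le _).trans (Polynomial.card_nthRoots k 1)
  set B := K ∪ K.image (fun s => s - 1) ∪ K.image (fun s => (s - 1)⁻¹) with hB
  have hBcard : B.card < (Finset.univ : Finset (ZMod p)).card := by
    have h1 := Finset.card_union_le (K ∪ K.image (fun s => s - 1)) (K.image (fun s => (s - 1)⁻¹))
    have h2 := Finset.card_union_le K (K.image (fun s => s - 1))
    have h3 := Finset.card_image_le (s := K) (f := fun s => s - 1)
    have h4 := Finset.card_image_le (s := K) (f := fun s => (s - 1)⁻¹)
    rw [Finset.card_univ, ZMod.card, hB]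
    omega
  obtain ⟨t, -, ht⟩ := Finset.exists_mem_notMem_of_card_lt_card hBcard
  simp only [hB, Finset.mem_union, Finset.mem_image, hmem, not_or, not_exists, not_and] at ht
  refine ⟨t, ht.1.1, fun h => ht.1.2 _ h (by ring), fun h => ht.2 _ h (by simp)⟩

/-- A diagonal ternary cubic form with nonzero coefficients over `ZMod p`, `p ≠ 3`, has a zero with a
coordinate equal to one. -/
theorem exists_zero_diagonal_cubic {p : ℕ} [Fact p.Prime] (hp3 : p ≠ 3) {a b c : ZMod p}
    (ha : a ≠ 0) (hb : b ≠ 0) (hc : c ≠ 0) :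
    (∃ y z : ZMod p, a + b * y ^ 3 + c * z ^ 3 = 0) ∨ ∃ z : ZMod p, b + c * z ^ 3 = 0 := by
  have hp : p.Prime := Fact.out
  have hmod : p % 3 = 1 ∨ p % 3 = 2 := by
    have : ¬ 3 ∣ p := fun h => hp3 ((Nat.prime_dvd_prime_iff_eq Nat.prime_three hp).1 h).symm
    omega
  rcases hmod with h1 | h2
  swap
  · obtain ⟨y, hy⟩ := exists_cube_eq_of_mod_three_eq_two (p := p) (m := p / 3) (by omega) (-a / b)
    refine Or.inl ⟨y, 0, ?_⟩
    rw [hy]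
    field_simp
    ring
  obtain ⟨k, hk⟩ : ∃ k, p = 3 * k + 1 := ⟨p / 3, by omega⟩
  have hkpos : k ≠ 0 := by
    have := hp.two_le
    omega
  have hkeven : Even k := by
    have := hp.eq_two_or_odd
    rw [Nat.even_iff]
    omega
  -- elements with equal `k`-th powers differ by a cube
  have key {u v : ZMod p} (hu : u ≠ 0) (h : u ^ k = v ^ k) : ∃ y, v = u * y ^ 3 := by
    obtain ⟨y, hy⟩ := exists_cube_eq_of_pow_eq_one hk (u := v / u)
      (by rw [div_pow, h, div_self]; rw [← h]; exact pow_ne_zero _ hu)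
    exact ⟨y, by rw [hy]; field_simp⟩
  have hroot {u : ZMod p} (hu : u ≠ 0) : (u ^ k) ^ 3 = 1 := by
    rw [← pow_mul, mul_comm, show 3 * k = p - 1 by omega]
    exact ZMod.pow_card_sub_one_eq_one hu
  have neg {u : ZMod p} : (-u) ^ k = u ^ k := hkeven.neg_pow u
  by_cases hab : b ^ k = a ^ k
  · obtain ⟨y, hy⟩ := key hb (hab.trans neg.symm)
    exact Or.inl ⟨y, 0, by rw [← hy]; ring⟩
  by_cases hac : c ^ k = a ^ k
  · obtain ⟨z, hz⟩ := key hc (hac.trans neg.symm)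
    exact Or.inl ⟨0, z, by rw [← hz]; ring⟩
  by_cases hbc : c ^ k = b ^ k
  · obtain ⟨z, hz⟩ := key hc (hbc.trans neg.symm)
    exact Or.inr ⟨z, by rw [← hz]; ring⟩
  obtain ⟨t, ht1, ht2, ht3⟩ := exists_pow_ne_one hk
  have ht0 : t ≠ 0 := by
    rintro rfl
    simp at ht2
  have hs0 : t + 1 ≠ 0 := fun h => ht1 (by rw [eq_neg_of_add_eq_zero_left h, neg, one_pow])
  have hts : (t + 1) ^ k ≠ t ^ k := fun h => ht3 (by
    rw [show 1 + t⁻¹ = (t + 1) / t by field_simp, div_pow, h, div_self (pow_ne_zero _ ht0)])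
  -- the three `k`-th powers of `a`, `a * t`, `a * (t + 1)` exhaust the cube roots of unity
  have trichotomy {u : ZMod p} (hu : u ≠ 0) (hua : u ^ k ≠ a ^ k) :
      u ^ k = (a * t) ^ k ∨ u ^ k = (a * (t + 1)) ^ k := by
    have e1 := hroot hu
    have e2 := hroot ha
    have e3 := hroot ht0
    have e4 := hroot hs0
    have ha' : a ^ k ≠ 0 := pow_ne_zero _ ha
    rw [mul_pow, mul_pow]
    generalize u ^ k = U at *
    generalize a ^ k = A at *
    generalize t ^ k = T at *
    generalize (t + 1) ^ k = S at *
    have f1 : U ^ 2 + U * A + A ^ 2 = 0 :=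
      mul_left_cancel₀ (sub_ne_zero.2 hua) (by linear_combination e1 - e2)
    have f2 : T ^ 2 + T + 1 = 0 :=
      mul_left_cancel₀ (sub_ne_zero.2 ht1) (by linear_combination e3)
    have f3 : S ^ 2 + S + 1 = 0 :=
      mul_left_cancel₀ (sub_ne_zero.2 ht2) (by linear_combination e4)
    have f4 : S + T + 1 = 0 :=
      mul_left_cancel₀ (sub_ne_zero.2 hts) (by linear_combination f3 - f2)
    have f5 : (U - A * T) * (U - A * S) = 0 := by
      linear_combination f1 + (A ^ 2 * T - U * A) * f4 - A ^ 2 * f2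
    rcases mul_eq_zero.1 f5 with h | h
    · exact Or.inl (sub_eq_zero.1 h)
    · exact Or.inr (sub_eq_zero.1 h)
  left
  rcases trichotomy hb hab with h | h <;> rcases trichotomy hc hac with h' | h'
  · exact absurd (h'.trans h.symm) hbc
  · obtain ⟨y, hy⟩ := key hb h
    obtain ⟨z, hz⟩ := key hc (h'.trans neg.symm)
    exact ⟨y, z, by rw [← hy, ← hz]; ring⟩
  · obtain ⟨y, hy⟩ := key hb (h.trans neg.symm)
    obtain ⟨z, hz⟩ := key hc h'
    exact ⟨y, z, by rw [← hy, ← hz]; ring⟩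
  · exact absurd (h'.trans h.symm) hbc

open Polynomial in
/-- By Hensel's lemma, if `p ∣ a + d` then `a * x ^ 3 + d` represents every element of the maximal
ideal of `ℤ_[p]`. -/
theorem PadicInt.exists_mul_cube_add_eq {p : ℕ} [Fact p.Prime] (hp3 : p ≠ 3) {a d : ℤ}
    (ha : ¬ (p : ℤ) ∣ a) (had : (p : ℤ) ∣ a + d) {m : ℤ_[p]} (hm : ‖m‖ < 1) :
    ∃ x : ℤ_[p], a * x ^ 3 + d = m := by
  let F : ℤ_[p][X] := C (a : ℤ_[p]) * X ^ 3 + C ((d : ℤ_[p]) - m)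
  have hder : ‖F.derivative.aeval (1 : ℤ_[p])‖ = 1 := by
    have : F.derivative.aeval (1 : ℤ_[p]) = ((a * 3 : ℤ) : ℤ_[p]) := by
      simp [F]
      norm_num
    rw [this, PadicInt.norm_intCast_eq_one_iff, isCoprime_comm]
    have hp : Prime (p : ℤ) := Nat.prime_iff_prime_int.1 Fact.out
    rw [hp.coprime_iff_not_dvd, hp.dvd_mul]
    rintro (h | h)
    · exact ha h
    · exact hp3 ((Nat.prime_dvd_prime_iff_eq Fact.out Nat.prime_three).1 (by exact_mod_cast h))
  have hval : ‖F.aeval (1 : ℤ_[p])‖ < ‖F.derivative.aeval (1 : ℤ_[p])‖ ^ 2 := by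
    have : F.aeval (1 : ℤ_[p]) = ((a + d : ℤ) : ℤ_[p]) + -m := by
      simp [F]
      ring
    rw [hder, one_pow, this]
    refine (PadicInt.nonarchimedean _ _).trans_lt (max_lt ?_ (by rwa [norm_neg]))
    exact PadicInt.norm_intCast_lt_one_iff.2 had
  obtain ⟨x, hx, -⟩ := hensels_lemma hval
  refine ⟨x, ?_⟩
  simp only [F, map_add, map_mul, aeval_C, map_pow, aeval_X, Algebra.algebraMap_self,
    RingHom.id_apply, map_sub] at hx
  linear_combination hx

/-- If the values in `V` include `a * x ^ 3 + d` with `p ∣ a + d` and `p ∤ 3 * a`, as well as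
`a * x ^ 3`, then quotients of elements of `V` are dense in `ℚ_[p]`. -/
theorem Padic.dense_quotients_of_mul_cube_add {p : ℕ} [Fact p.Prime] (hp3 : p ≠ 3) {a d : ℤ}
    (ha : ¬ (p : ℤ) ∣ a) (had : (p : ℤ) ∣ a + d) {V : Set ℤ}
    (hV : ∀ x : ℤ, a * x ^ 3 + d ∈ V) (hV' : ∀ x : ℤ, a * x ^ 3 ∈ V) :
    Dense {q : ℚ_[p] | ∃ v ∈ V, ∃ w ∈ V, w ≠ 0 ∧ q = (v : ℚ_[p]) / (w : ℚ_[p])} := by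
  intro q
  have hp : p.Prime := Fact.out
  have ha0 : a ≠ 0 := by
    rintro rfl
    simp at ha
  let w (n : ℕ) : ℤ := a * ((p : ℤ) ^ n) ^ 3
  have hw (n : ℕ) : w n ≠ 0 :=
    mul_ne_zero ha0 (pow_ne_zero _ (pow_ne_zero _ (by exact_mod_cast hp.ne_zero)))
  have hlim : Filter.Tendsto (fun n => q * (w n : ℚ_[p])) Filter.atTop (nhds 0) := by
    have h1 : Filter.Tendsto (fun n : ℕ => (p : ℚ_[p]) ^ n) Filter.atTop (nhds 0) :=
      tendsto_pow_atTop_nhds_zero_of_norm_lt_one Padic.norm_p_lt_one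
    have h2 := ((h1.pow 3).const_mul (a : ℚ_[p])).const_mul q
    simpa [w] using h2
  obtain ⟨n, hn⟩ := ((hlim.norm).eventually_lt_const (show ‖(0 : ℚ_[p])‖ < 1 by simp)).exists
  have hwn : (w n : ℚ_[p]) ≠ 0 := by exact_mod_cast hw n
  obtain ⟨x, hx⟩ := PadicInt.exists_mul_cube_add_eq hp3 ha had
    (m := ⟨q * (w n : ℚ_[p]), hn.le⟩) hn
  have hxq : (a : ℚ_[p]) * (x : ℚ_[p]) ^ 3 + d = q * (w n : ℚ_[p]) := by
    simpa using congrArg ((↑) : ℤ_[p] → ℚ_[p]) hx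
  let f : ℤ_[p] → ℚ_[p] := fun y => ((a : ℚ_[p]) * (y : ℚ_[p]) ^ 3 + d) / (w n : ℚ_[p])
  have hf : Continuous f := by fun_prop
  have hfx : f x = q := by
    simp only [f]
    rw [hxq, mul_div_cancel_right₀ _ hwn]
  rw [← hfx]
  refine map_mem_closure hf (PadicInt.denseRange_intCast x) ?_
  rintro _ ⟨y, rfl⟩
  exact ⟨_, hV y, _, hV' _, hw n, by simp [f, w]⟩

theorem stmt_12 (p : ℕ) [Fact p.Prime] (hp3 : p ≠ 3) (a b c : ℤ)
    (habc : ¬ (p : ℤ) ∣ a * b * c) :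
    Dense {q : ℚ_[p] | ∃ x y z X Y Z : ℤ,
      a * X ^ 3 + b * Y ^ 3 + c * Z ^ 3 ≠ 0 ∧
      q = ((a * x ^ 3 + b * y ^ 3 + c * z ^ 3 : ℤ) : ℚ_[p]) /
          ((a * X ^ 3 + b * Y ^ 3 + c * Z ^ 3 : ℤ) : ℚ_[p])} := by
  have ha : ¬ (p : ℤ) ∣ a := fun h => habc ((h.mul_right b).mul_right c)
  have hb : ¬ (p : ℤ) ∣ b := fun h => habc ((h.mul_left a).mul_right c)
  have hc : ¬ (p : ℤ) ∣ c := fun h => habc (h.mul_left (a * b))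
  let V : Set ℤ := {v | ∃ x y z : ℤ, v = a * x ^ 3 + b * y ^ 3 + c * z ^ 3}
  suffices h : Dense {q : ℚ_[p] | ∃ v ∈ V, ∃ w ∈ V, w ≠ 0 ∧ q = (v : ℚ_[p]) / (w : ℚ_[p])} by
    refine h.mono ?_
    rintro q ⟨_, ⟨x, y, z, rfl⟩, _, ⟨X, Y, Z, rfl⟩, hw, hq⟩
    exact ⟨x, y, z, X, Y, Z, hw, hq⟩
  have cast_ne {n : ℤ} (h : ¬ (p : ℤ) ∣ n) : (n : ZMod p) ≠ 0 := by
    rwa [Ne, ZMod.intCast_zmod_eq_zero_iff_dvd]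
  rcases exists_zero_diagonal_cubic hp3 (cast_ne ha) (cast_ne hb) (cast_ne hc) with
    ⟨y, z, h⟩ | ⟨z, h⟩
  · obtain ⟨y, rfl⟩ := ZMod.intCast_surjective y
    obtain ⟨z, rfl⟩ := ZMod.intCast_surjective z
    refine Padic.dense_quotients_of_mul_cube_add hp3 ha (d := b * y ^ 3 + c * z ^ 3) ?_
      (fun x => ⟨x, y, z, by ring⟩) (fun x => ⟨x, 0, 0, by ring⟩)
    rw [← ZMod.intCast_zmod_eq_zero_iff_dvd]
    push_cast
    rw [← h]
    ring
  · obtain ⟨z, rfl⟩ := ZMod.intCast_surjective z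
    refine Padic.dense_quotients_of_mul_cube_add hp3 hb (d := c * z ^ 3) ?_
      (fun x => ⟨0, x, z, by ring⟩) (fun x => ⟨0, x, 0, by ring⟩)
    rw [← ZMod.intCast_zmod_eq_zero_iff_dvd]
    push_cast
    exact h
end

section
/- Let p ≠ 3 be a prime and f(x,y,z) = a x^3 + b x y^2 + c y^3 + (d x + e y) z^2 + f z^3 a cubic form over F_p with a·c·f ≠ 0. Then f has a non-singular zero over F_p, i.e., there exists (x_0,y_0,z_0) ∈ F_p^3 with f(x_0,y_0,z_0) = 0 and some partial derivative of f nonzero at (x_0,y_0,z_0). -/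
/-- The coefficients of the cubic form
`a x³ + b x y² + c y³ + (d x + e y) z² + f z³`. -/
structure CubicCoeffs (R : Type*) where
  (a b c d e f : R)

namespace CubicCoeffs

variable {R S : Type*} [CommRing R] [CommRing S]

/-- The value of the cubic form at a vector. -/
def eval (k : CubicCoeffs R) (v : Fin 3 → R) : R :=
  k.a * v 0 ^ 3 + k.b * v 0 * v 1 ^ 2 + k.c * v 1 ^ 3 + (k.d * v 0 + k.e * v 1) * v 2 ^ 2 +
    k.f * v 2 ^ 3

/-- The derivative at `v`, applied to `w`. -/
def polar (k : CubicCoeffs R) (v w : Fin 3 → R) : R :=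
  (3 * k.a * v 0 ^ 2 + k.b * v 1 ^ 2 + k.d * v 2 ^ 2) * w 0 +
  (2 * k.b * v 0 * v 1 + 3 * k.c * v 1 ^ 2 + k.e * v 2 ^ 2) * w 1 +
  (2 * (k.d * v 0 + k.e * v 1) * v 2 + 3 * k.f * v 2 ^ 2) * w 2

/-- The full polarization, a symmetric trilinear form. -/
def tri (k : CubicCoeffs R) (u v w : Fin 3 → R) : R :=
  6 * k.a * u 0 * v 0 * w 0 +
  2 * k.b * (u 0 * v 1 * w 1 + u 1 * v 0 * w 1 + u 1 * v 1 * w 0) +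
  6 * k.c * u 1 * v 1 * w 1 +
  2 * k.d * (u 0 * v 2 * w 2 + u 2 * v 0 * w 2 + u 2 * v 2 * w 0) +
  2 * k.e * (u 1 * v 2 * w 2 + u 2 * v 1 * w 2 + u 2 * v 2 * w 1) +
  6 * k.f * u 2 * v 2 * w 2

/-- The image of the coefficients under a ring homomorphism. -/
def map (φ : R →+* S) (k : CubicCoeffs R) : CubicCoeffs S :=
  ⟨φ k.a, φ k.b, φ k.c, φ k.d, φ k.e, φ k.f⟩

variable (k : CubicCoeffs R) (α β : R) (u v w w' : Fin 3 → R)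

theorem eval_comb : k.eval (α • u + β • v) =
    α ^ 3 * k.eval u + α ^ 2 * β * k.polar u v + α * β ^ 2 * k.polar v u + β ^ 3 * k.eval v := by
  simp only [eval, polar, Pi.add_apply, Pi.smul_apply, smul_eq_mul]; ring

theorem polar_comb : k.polar (α • u + β • v) w =
    α ^ 2 * k.polar u w + α * β * k.tri u v w + β ^ 2 * k.polar v w := by
  simp only [polar, tri, Pi.add_apply, Pi.smul_apply, smul_eq_mul]; ring

theorem polar_smul : k.polar (α • u) w = α ^ 2 * k.polar u w := by
  simp only [polar, Pi.smul_apply, smul_eq_mul]; ring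

theorem eval_smul : k.eval (α • u) = α ^ 3 * k.eval u := by
  simp only [eval, Pi.smul_apply, smul_eq_mul]; ring

theorem polar_comb_right : k.polar u (α • v + β • w) = α * k.polar u v + β * k.polar u w := by
  simp only [polar, Pi.add_apply, Pi.smul_apply, smul_eq_mul]; ring

theorem polar_smul_right : k.polar u (α • v) = α * k.polar u v := by
  simp only [polar, Pi.smul_apply, smul_eq_mul]; ring

theorem tri_comb_right : k.tri u v (α • w + β • w') = α * k.tri u v w + β * k.tri u v w' := by
  simp only [tri, Pi.add_apply, Pi.smul_apply, smul_eq_mul]; ring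

theorem tri_smul_right : k.tri u v (α • w) = α * k.tri u v w := by
  simp only [tri, Pi.smul_apply, smul_eq_mul]; ring

theorem polar_self : k.polar v v = 3 * k.eval v := by
  simp only [polar, eval]; ring

theorem tri_self_left : k.tri u u v = 2 * k.polar u v := by
  simp only [polar, tri]; ring

theorem tri_swap : k.tri u v w = k.tri v u w := by
  simp only [tri]; ring

theorem tri_rotate : k.tri u v w = k.tri v w u := by
  simp only [tri]; ring

theorem tri_self_right : k.tri u v v = 2 * k.polar v u := by
  rw [tri_rotate, tri_self_left]

theorem eval_map (φ : R →+* S) : (k.map φ).eval (φ ∘ v) = φ (k.eval v) := by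
  simp [eval, map]

theorem polar_map (φ : R →+* S) : (k.map φ).polar (φ ∘ v) (φ ∘ w) = φ (k.polar v w) := by
  simp [polar, map, map_ofNat]

theorem map_map {T : Type*} [CommRing T] (φ : R →+* S) (ψ : S →+* T) :
    (k.map φ).map ψ = k.map (ψ.comp φ) := rfl

/-- The third intersection point of the cubic with the line that is tangent at its point `v`
with direction `t`. -/
def tangentThird (v t : Fin 3 → R) : Fin 3 → R := k.eval t • v + (-k.polar t v) • t

theorem tangentThird_comb {v t t' : Fin 3 → R} (hv : k.eval v = 0) (ht : k.polar v t = 0)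
    (h : t' = α • v + β • t) : k.tangentThird v t' = β ^ 3 • k.tangentThird v t := by
  have h1 : k.eval t' = β ^ 2 * α * k.polar t v + β ^ 3 * k.eval t := by
    rw [h, eval_comb, hv, ht]; ring
  have h2 : k.polar t' v = β ^ 2 * k.polar t v := by
    rw [h, polar_comb, polar_self, hv, tri_rotate, tri_rotate, tri_self_left, ht]; ring
  rw [tangentThird, h1, h2, h, tangentThird]
  ext i
  simp only [Pi.add_apply, Pi.smul_apply, smul_eq_mul]
  ring

theorem polar_tangentThird (t : Fin 3 → R) : k.polar (k.tangentThird v t) w =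
    k.eval t ^ 2 * k.polar v w - k.eval t * k.polar t v * k.tri v t w +
      k.polar t v ^ 2 * k.polar t w := by
  rw [tangentThird, polar_comb]; ring

theorem sq_polar_dvd {v w e t : Fin 3 → R} (hv : k.eval v = 0) (hw : k.eval w = 0)
    (ht : k.polar v t = 0)
    (h : k.polar v e • w + (-k.polar v w) • e = α • v + β • t) :
    k.polar v w ^ 2 ∣ β ^ 6 * k.polar (k.tangentThird v t) w := by
  set g := k.polar v w with hg
  set s := k.polar v e • w + (-g) • e with hs
  have h1 : k.eval s = g * (-(k.polar v e ^ 2 * k.polar w e) +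
      g * (k.polar v e * k.polar e w - g * k.eval e)) := by
    rw [hs, eval_comb, hw]; ring
  have h2 : k.polar s v = k.polar v e ^ 2 * k.polar w v +
      g * (g * k.polar e v - k.polar v e * k.tri w e v) := by
    rw [hs, polar_comb]; ring
  have h3 : k.polar s w = g * (-(2 * k.polar v e * k.polar w e) + g * k.polar e w) := by
    rw [hs, polar_comb, polar_self, hw, tri_rotate, tri_rotate, tri_self_left]; ring
  have h4 : k.tri v s w = 2 * k.polar v e * k.polar w v - g * k.tri w v e := by
    rw [tri_swap, tri_rotate, tri_swap, hs, tri_comb_right, tri_rotate k w v w, tri_self_right]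
    ring
  have h5 : β ^ 6 * k.polar (k.tangentThird v t) w = k.polar (k.tangentThird v s) w := by
    rw [k.tangentThird_comb α β hv ht h, polar_smul]; ring
  rw [h5, polar_tangentThird, h1, h2, h3, h4, ← hg]
  generalize k.polar v e = x
  generalize k.polar w e = y
  generalize k.polar w v = m
  generalize g * k.polar e v - x * k.tri w e v = c₁
  generalize k.tri w v e = c₂
  generalize k.polar e w = c₃
  generalize k.eval e = c₄
  refine ⟨g * (-(x ^ 2 * y) + g * (x * c₃ - g * c₄)) ^ 2 + (x ^ 2 * m + g * c₁) ^ 2 * c₃ +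
    (x ^ 2 * m + g * c₁) * (-(x ^ 2 * y) * c₂ * -1 - (x * c₃ - g * c₄) * (2 * x * m - g * c₂) -
      2 * x * y * c₁ - 2 * x ^ 2 * y * c₂), ?_⟩
  ring

section Derivation

variable (D : Derivation ℤ R R)

/-- All coefficients are constants of the derivation. -/
def IsConst : Prop := D k.a = 0 ∧ D k.b = 0 ∧ D k.c = 0 ∧ D k.d = 0 ∧ D k.e = 0 ∧ D k.f = 0

variable {k D}

theorem IsConst.map_eval (h : k.IsConst D) : D (k.eval v) = k.polar v (D ∘ v) := by
  obtain ⟨ha, hb, hc, hd, he, hf⟩ := h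
  simp only [eval, polar, map_add, Derivation.leibniz, Derivation.leibniz_pow, smul_eq_mul,
    Function.comp, ha, hb, hc, hd, he, hf, nsmul_eq_mul]
  push_cast; ring

theorem IsConst.map_polar (h : k.IsConst D) :
    D (k.polar v w) = k.tri v w (D ∘ v) + k.polar v (D ∘ w) := by
  obtain ⟨ha, hb, hc, hd, he, hf⟩ := h
  have h2 : D 2 = 0 := D.map_natCast 2
  have h3 : D 3 = 0 := D.map_natCast 3
  simp only [tri, polar, map_add, Derivation.leibniz, Derivation.leibniz_pow, smul_eq_mul,
    Function.comp, ha, hb, hc, hd, he, hf, h2, h3, nsmul_eq_mul]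
  push_cast; ring

end Derivation

section Line

theorem eval_comb_eq_zero {u v : Fin 3 → R} (hu : k.eval u = 0) (huv : k.polar u v = 0)
    (hvu : k.polar v u = 0) (hv : k.eval v = 0) : k.eval (α • u + β • v) = 0 := by
  rw [eval_comb, hu, huv, hvu, hv]; ring

theorem polar_comb_comb_eq_zero {u v : Fin 3 → R} (hu : k.eval u = 0) (huv : k.polar u v = 0)
    (hvu : k.polar v u = 0) (hv : k.eval v = 0) (α' β' : R) :
    k.polar (α • u + β • v) (α' • u + β' • v) = 0 := by
  rw [polar_comb, polar_comb_right, polar_comb_right, tri_comb_right, tri_self_right,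
    tri_rotate k u v u, tri_rotate k v u u, tri_self_left, polar_self, polar_self, hu, huv, hvu, hv]
  ring

/-- A cubic form that does not vanish at `(3 * c, -2 * b, 0)` vanishes on no plane. -/
theorem mul_eq_mul_of_line [IsDomain R] (ha : k.a ≠ 0) (hc : k.c ≠ 0) (hf : k.f ≠ 0)
    (hk : k.eval ![3 * k.c, -2 * k.b, 0] ≠ 0) {u v : Fin 3 → R} (hu : k.eval u = 0)
    (huv : k.polar u v = 0) (hvu : k.polar v u = 0) (hv : k.eval v = 0) :
    ∀ i j, u i * v j = u j * v i := by
  obtain ⟨l₀, h₀⟩ : ∃ l, l = u 1 * v 2 - u 2 * v 1 := ⟨_, rfl⟩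
  obtain ⟨l₁, h₁⟩ : ∃ l, l = u 2 * v 0 - u 0 * v 2 := ⟨_, rfl⟩
  obtain ⟨l₂, h₂⟩ : ∃ l, l = u 0 * v 1 - u 1 * v 0 := ⟨_, rfl⟩
  have hA : -v 2 • u + u 2 • v = ![l₁, -l₀, 0] := by
    ext i; fin_cases i <;> simp [h₀, h₁] <;> ring
  have hB : -v 1 • u + u 1 • v = ![-l₂, 0, l₀] := by
    ext i; fin_cases i <;> simp [h₀, h₂] <;> ring
  have eA := k.eval_comb_eq_zero (-v 2) (u 2) hu huv hvu hv
  have eB := k.eval_comb_eq_zero (-v 1) (u 1) hu huv hvu hv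
  have eAB := k.polar_comb_comb_eq_zero (-v 2) (u 2) hu huv hvu hv (-v 1) (u 1)
  rw [hA] at eA eAB
  rw [hB] at eB eAB
  simp only [eval, polar, Matrix.cons_val_zero, Matrix.cons_val_one, Matrix.cons_val] at eA eB eAB
  have z₀ : l₀ = 0 := by
    by_contra z₀
    have z₂ : l₂ ≠ 0 := by
      rintro rfl
      exact mul_ne_zero hf (pow_ne_zero 3 z₀) (by linear_combination eB)
    have z₁ : l₁ ≠ 0 := by
      rintro rfl
      exact mul_ne_zero hc (pow_ne_zero 3 z₀) (by linear_combination -eA)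
    have e1 : k.b * l₀ ^ 2 = -(3 * k.a * l₁ ^ 2) := by
      have := (mul_eq_zero.mp (show l₂ * (3 * k.a * l₁ ^ 2 + k.b * l₀ ^ 2) = 0 by
        linear_combination -eAB)).resolve_left z₂
      linear_combination this
    have e2 : 3 * k.c * l₀ = 2 * k.b * l₁ := by
      refine mul_right_cancel₀ (pow_ne_zero 2 z₀) ?_
      linear_combination -3 * eA + l₁ * e1
    apply hk
    have : l₀ ^ 3 * k.eval ![3 * k.c, -2 * k.b, 0] = 0 := by
      have e3 : l₀ • ![3 * k.c, -2 * k.b, 0] = (2 * k.b) • ![l₁, -l₀, 0] := by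
        ext i; fin_cases i
        · simp; linear_combination e2
        · simp; ring
        · simp
      rw [← eval_smul, e3, eval_smul]
      simp only [eval, Matrix.cons_val_zero, Matrix.cons_val_one, Matrix.cons_val]
      linear_combination (2 * k.b) ^ 3 * eA
    exact (mul_eq_zero.mp this).resolve_left (pow_ne_zero 3 z₀)
  have z₁ : l₁ = 0 := by
    rw [z₀] at eA
    have : k.a * l₁ ^ 3 = 0 := by linear_combination eA
    exact pow_eq_zero_iff (by norm_num) |>.mp ((mul_eq_zero.mp this).resolve_left ha)
  have z₂ : l₂ = 0 := by
    rw [z₀] at eB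
    have : k.a * l₂ ^ 3 = 0 := by linear_combination -eB
    exact pow_eq_zero_iff (by norm_num) |>.mp ((mul_eq_zero.mp this).resolve_left ha)
  rw [z₀] at h₀
  rw [z₁] at h₁
  rw [z₂] at h₂
  intro i j
  fin_cases i <;> fin_cases j <;> simp <;> grind

end Line

section Wronskian

variable {k} {D : Derivation ℤ R R}

theorem comp_comb (D : Derivation ℤ R R) : D ∘ (α • u + β • v) =
    D α • u + α • (D ∘ u) + (D β • v + β • (D ∘ v)) := by
  ext i
  simp only [Function.comp, Pi.add_apply, Pi.smul_apply, smul_eq_mul, map_add, Derivation.leibniz]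
  ring

/-- The determinant of three vectors. -/
def det₃ (u v w : Fin 3 → R) : R :=
  u 0 * (v 1 * w 2 - v 2 * w 1) - u 1 * (v 0 * w 2 - v 2 * w 0) + u 2 * (v 0 * w 1 - v 1 * w 0)

theorem det₃_smul_eq (r : Fin 3 → R) : det₃ u v r • w =
    det₃ w v r • u + det₃ u w r • v + det₃ u v w • r := by
  ext i
  fin_cases i <;> simp [det₃] <;> ring

/-- Let `t = D v` be a tangent vector at the generic point `v = (x, 1, s)` of the cubic, where
`D s = 1`. If the tangent line at the third point of the tangent line at `v` passes through
a point `w` with `D w = 0`, then `w` is on the tangent line at `v`, provided that the cubic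
contains no line. -/
theorem polar_eq_zero_of_polar_tangentThird_eq_zero [IsDomain R] (h2 : (2 : R) ≠ 0)
    (h3 : (3 : R) ≠ 0) (hk : k.IsConst D)
    (hline : ∀ u v : Fin 3 → R, k.eval u = 0 → k.polar u v = 0 → k.polar v u = 0 →
      k.eval v = 0 → ∀ i j, u i * v j = u j * v i)
    {x s : R} (hs : D s = 1) (hv : k.eval ![x, 1, s] = 0) (hx : k.polar ![x, 1, s] ![1, 0, 0] ≠ 0)
    (hw : D ∘ w = 0) (h : k.polar (k.tangentThird ![x, 1, s] ![D x, 0, 1]) w = 0) :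
    k.polar ![x, 1, s] w = 0 := by
  set v : Fin 3 → R := ![x, 1, s] with hvdef
  set t : Fin 3 → R := ![D x, 0, 1] with htdef
  have hDv : D ∘ v = t := by
    ext i; fin_cases i <;> simp [hvdef, htdef, hs]
  have hDt : D ∘ t = D (D x) • ![1, 0, 0] := by
    ext i; fin_cases i <;> simp [htdef]
  have hvt : k.polar v t = 0 := by
    rw [← hDv, ← hk.map_eval, hv, map_zero]
  have hvDt : D (D x) * k.polar v ![1, 0, 0] = -2 * k.polar t v := by
    have := hk.map_polar v t
    rw [hvt, map_zero, hDv, hDt, polar_smul_right, tri_self_right] at this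
    linear_combination -this
  have hDκ : D (k.polar t v) = D (D x) * k.tri t v ![1, 0, 0] + 3 * k.eval t := by
    rw [hk.map_polar, hDv, hDt, tri_smul_right, polar_self]
  have hκ : k.polar t v ≠ 0 := by
    intro hκ
    have hDDx : D (D x) = 0 := by
      rw [hκ, mul_zero] at hvDt
      exact (mul_eq_zero.mp hvDt).resolve_right hx
    rw [hκ, hDDx, map_zero, zero_mul, zero_add] at hDκ
    have := hline v t hv hvt hκ ((mul_eq_zero.mp hDκ.symm).resolve_left h3) 1 2
    simp [hvdef, htdef] at this
  have hDDx : D (D x) ≠ 0 := by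
    intro h0
    rw [h0, zero_mul, eq_comm, mul_eq_zero] at hvDt
    exact hvDt.elim (by simpa using h2) hκ
  set T := k.tangentThird v t with hT
  have hTeq : T = k.eval t • v + (-k.polar t v) • t := rfl
  have hT0 : k.eval T = 0 := by
    rw [hTeq, eval_comb, hv, hvt]; ring
  have hTv : k.polar T v = k.polar t v ^ 3 := by
    rw [hTeq, polar_comb, polar_self, hv, tri_rotate, tri_rotate, tri_self_left, hvt]; ring
  have hTDT : k.polar T (D ∘ T) = 0 := by
    rw [← hk.map_eval, hT0, map_zero]
  have hdet : det₃ T (D ∘ T) v ≠ 0 := by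
    have : det₃ T (D ∘ T) v = k.polar t v ^ 2 * D (D x) := by
      rw [hTeq, comp_comb, hDv, hDt]
      simp [det₃, hvdef, htdef]
      ring
    rw [this]
    exact mul_ne_zero (pow_ne_zero 2 hκ) hDDx
  have hspan (r : Fin 3 → R) (hr : k.polar T r = 0) :
      ∃ α β : R, det₃ T (D ∘ T) v • r = α • T + β • (D ∘ T) := by
    have e := det₃_smul_eq T (D ∘ T) r v
    have e' := congrArg (k.polar T) e
    rw [← one_smul R (det₃ r (D ∘ T) v • T + det₃ T r v • (D ∘ T)), polar_smul_right, hr,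
      polar_comb_right, polar_comb_right, polar_self, hT0, hTDT, hTv] at e'
    have e0 : det₃ T (D ∘ T) r * k.polar t v ^ 3 = 0 := by linear_combination -e'
    rw [(mul_eq_zero.mp e0).resolve_right (pow_ne_zero 3 hκ), zero_smul, add_zero] at e
    exact ⟨_, _, e⟩
  have htri (α β : R) : k.tri T (D ∘ T) (α • T + β • (D ∘ T)) = 2 * β * k.polar (D ∘ T) T := by
    rw [tri_comb_right, tri_self_right, tri_rotate, tri_rotate, tri_self_left, hTDT]; ring
  have hκT : k.polar (D ∘ T) T ≠ 0 := by
    intro hκT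
    have e1 : k.polar T (D ∘ (D ∘ T)) = 0 := by
      have := hk.map_polar T (D ∘ T)
      rw [hTDT, map_zero, tri_self_right, hκT] at this
      linear_combination -this
    have e2 : k.tri T (D ∘ T) (D ∘ (D ∘ T)) + 3 * k.eval (D ∘ T) = 0 := by
      have := hk.map_polar (D ∘ T) T
      rw [hκT, map_zero, polar_self, tri_swap] at this
      exact this.symm
    obtain ⟨α, β, e3⟩ := hspan _ e1
    have e4 := congrArg (k.tri T (D ∘ T)) e3
    rw [htri, hκT, mul_zero, tri_smul_right] at e4
    have e5 := (mul_eq_zero.mp e4).resolve_left hdet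
    rw [e5, zero_add] at e2
    have := hline T (D ∘ T) hT0 hTDT hκT ((mul_eq_zero.mp e2).resolve_left h3)
    apply hdet
    rw [det₃]
    linear_combination v 2 * this 0 1 - v 1 * this 0 2 + v 0 * this 1 2
  obtain ⟨α, β, e1⟩ := hspan w h
  have e2 : k.tri T (D ∘ T) w = 0 := by
    have := hk.map_polar T w
    rw [h, map_zero, hw] at this
    have z : k.polar T 0 = 0 := by simp [polar]
    rw [tri_swap, tri_rotate, this, z, add_zero]
  have e3 := congrArg (k.tri T (D ∘ T)) e1
  rw [htri, tri_smul_right, e2, mul_zero, eq_comm] at e3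
  have hβ : β = 0 := by simpa [h2, hκT] using e3
  rw [hβ, zero_smul, add_zero] at e1
  have e4 := congrArg (k.polar v) e1
  rw [polar_smul_right, polar_smul_right, hTeq, polar_comb_right, polar_self, hv, hvt] at e4
  have e5 : det₃ T (D ∘ T) v * k.polar v w = 0 := by
    rw [hTeq]; linear_combination e4
  exact (mul_eq_zero.mp e5).resolve_left hdet

end Wronskian

section Coprime

theorem sq_polar_dvd_of_isCoprime {x y x' y' : R} (hP : k.eval ![x, y, 1] = 0)
    (hQ : k.eval ![x', y', 1] = 0) (h : IsCoprime (x' - x) (y' - y)) :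
    k.polar ![x, y, 1] ![x', y', 1] ^ 2 ∣
      k.polar (k.tangentThird ![x, y, 1]
        ![-k.polar ![x, y, 1] ![0, 1, 0], k.polar ![x, y, 1] ![1, 0, 0], 0]) ![x', y', 1] := by
  set t := ![-k.polar ![x, y, 1] ![0, 1, 0], k.polar ![x, y, 1] ![1, 0, 0], 0] with ht
  have hPt : k.polar ![x, y, 1] t = 0 := by simp [ht, polar]; ring
  have hG : k.polar ![x, y, 1] ![x', y', 1] =
      k.polar ![x, y, 1] ![1, 0, 0] * (x' - x) + k.polar ![x, y, 1] ![0, 1, 0] * (y' - y) := by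
    have := k.polar_self ![x, y, 1]
    rw [hP] at this
    simp [polar] at this ⊢
    linear_combination this
  have h0 := k.sq_polar_dvd (k.polar ![x, y, 1] ![1, 0, 0]) (y' - y) (e := ![1, 0, 0]) hP hQ hPt (by
    rw [hG]; ext i; fin_cases i <;> simp [ht] <;> ring)
  have h1 := k.sq_polar_dvd (k.polar ![x, y, 1] ![0, 1, 0]) (-(x' - x)) (e := ![0, 1, 0]) hP hQ hPt
    (by rw [hG]; ext i; fin_cases i <;> simp [ht] <;> ring)
  rw [Even.neg_pow (by decide)] at h1
  generalize k.polar (k.tangentThird ![x, y, 1] t) ![x', y', 1] = N at h0 h1 ⊢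
  obtain ⟨α, β, e⟩ := h.pow (m := 6) (n := 6)
  have := dvd_add (Dvd.dvd.mul_left h1 α) (Dvd.dvd.mul_left h0 β)
  rwa [← mul_assoc, ← mul_assoc, ← add_mul, e, one_mul] at this

variable {p : ℕ} [Fact p.Prime]

theorem exists_zmod_eq {K : Type*} [Field K] [Algebra (ZMod p) K] {x : K} (h : x ^ p = x) :
    ∃ z : ZMod p, algebraMap (ZMod p) K z = x := by
  have := charP_of_injective_algebraMap (algebraMap (ZMod p) K).injective p
  rw [← Subfield.mem_bot_iff_pow_eq_self K p, ← ZMod.fieldRange_castHom_eq_bot p] at h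
  obtain ⟨z, hz⟩ := h
  exact ⟨z, hz ▸ RingHom.congr_fun (Subsingleton.elim _ _) z⟩

/-- The points over `𝔽_p` of the affine line are the zeros of `x ^ p - x`. -/
theorem isCoprime_pow_sub {k : CubicCoeffs (ZMod p)} (hk : ∀ v, k.eval v = 0 → v = 0)
    [Algebra (ZMod p) R] {x y : R} (h : (k.map (algebraMap _ R)).eval ![x, y, 1] = 0) :
    IsCoprime (x ^ p - x) (y ^ p - y) := by
  rw [← Ideal.isCoprime_span_singleton_iff, Ideal.isCoprime_iff_sup_eq]
  by_contra hI
  obtain ⟨M, hM, hIM⟩ := Ideal.exists_le_maximal _ hI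
  let _ := Ideal.Quotient.field M
  rw [sup_le_iff, Ideal.span_singleton_le_iff_mem, Ideal.span_singleton_le_iff_mem,
    ← Ideal.Quotient.eq, ← Ideal.Quotient.eq, map_pow, map_pow] at hIM
  obtain ⟨X, hX⟩ := exists_zmod_eq hIM.1
  obtain ⟨Y, hY⟩ := exists_zmod_eq hIM.2
  have h' := congrArg (Ideal.Quotient.mk M) h
  rw [← eval_map, map_zero, map_map] at h'
  have e : Ideal.Quotient.mk M ∘ ![x, y, 1] = algebraMap (ZMod p) (R ⧸ M) ∘ ![X, Y, 1] := by
    ext i; fin_cases i <;> simp [hX, hY]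
  have e' : (Ideal.Quotient.mk M).comp (algebraMap (ZMod p) R) = algebraMap (ZMod p) (R ⧸ M) := rfl
  rw [e, e', eval_map, map_eq_zero] at h'
  simpa using congrFun (hk _ h') 2

end Coprime

section PowerSeries

open PowerSeries

variable {F K L : Type*} [Field F] [Field K] [Algebra F K] [Field L] [Algebra F L]

theorem exists_eq_of_mem_adjoin {k : CubicCoeffs F} (ha : k.a ≠ 0) {x y : L}
    (h : (k.map (algebraMap F L)).eval ![x, y, 1] = 0) {z : L} (hz : z ∈ Algebra.adjoin F {x, y}) :
    ∃ r₀ r₁ r₂ : Polynomial F, z = Polynomial.aeval y r₀ * x ^ 0 + Polynomial.aeval y r₁ * x ^ 1 +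
      Polynomial.aeval y r₂ * x ^ 2 := by
  induction hz using Algebra.adjoin_induction with
  | mem z hz =>
    obtain rfl | rfl := hz
    · exact ⟨0, 1, 0, by simp⟩
    · exact ⟨.X, 0, 0, by simp⟩
  | algebraMap r => exact ⟨.C r, 0, 0, by simp⟩
  | add z z' _ _ hz hz' =>
    obtain ⟨r₀, r₁, r₂, rfl⟩ := hz
    obtain ⟨s₀, s₁, s₂, rfl⟩ := hz'
    exact ⟨r₀ + s₀, r₁ + s₁, r₂ + s₂, by simp only [map_add]; ring⟩
  | mul z z' _ _ hz hz' =>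
    obtain ⟨r₀, r₁, r₂, rfl⟩ := hz
    obtain ⟨s₀, s₁, s₂, rfl⟩ := hz'
    obtain ⟨q₀, q₁, hq⟩ : ∃ q₀ q₁ : Polynomial F,
        x ^ 3 = Polynomial.aeval y q₀ + Polynomial.aeval y q₁ * x := by
      refine ⟨.C (-k.a⁻¹) * (.C k.c * .X ^ 3 + .C k.e * .X + .C k.f),
        .C (-k.a⁻¹) * (.C k.b * .X ^ 2 + .C k.d), ?_⟩
      have ha' : algebraMap F L k.a ≠ 0 := by simpa using ha
      simp [eval, map] at h
      simp
      field_simp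
      linear_combination h
    refine ⟨r₀ * s₀ + (r₁ * s₂ + r₂ * s₁) * q₀,
      r₀ * s₁ + r₁ * s₀ + (r₁ * s₂ + r₂ * s₁) * q₁ + r₂ * s₂ * q₀,
      r₀ * s₂ + r₁ * s₁ + r₂ * s₀ + r₂ * s₂ * q₁, ?_⟩
    simp only [map_add, map_mul]
    generalize Polynomial.aeval y r₀ = r₀
    generalize Polynomial.aeval y r₁ = r₁
    generalize Polynomial.aeval y r₂ = r₂
    generalize Polynomial.aeval y s₀ = s₀
    generalize Polynomial.aeval y s₁ = s₁
    generalize Polynomial.aeval y s₂ = s₂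
    linear_combination (r₁ * s₂ + r₂ * s₁ + r₂ * s₂ * x) * hq

variable [Algebra K⟦X⟧ L] [IsScalarTower F K⟦X⟧ L]

theorem exists_X_pow_mul_aeval_eq {y : L} (hy : algebraMap K⟦X⟧ L X * y = 1) {r : Polynomial F}
    {m : ℕ} (hr : r.natDegree < m + 1) : ∃ t : K⟦X⟧,
      algebraMap K⟦X⟧ L (X ^ m) * Polynomial.aeval y r = algebraMap K⟦X⟧ L t ∧
        constantCoeff t = algebraMap F K (r.coeff m) := by
  refine ⟨∑ j ∈ Finset.range (m + 1), algebraMap F K⟦X⟧ (r.coeff j) * X ^ (m - j), ?_, ?_⟩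
  · rw [Polynomial.aeval_eq_sum_range' hr, Finset.mul_sum, map_sum]
    refine Finset.sum_congr rfl fun j hj ↦ ?_
    have hj : j ≤ m := by simpa [Nat.lt_succ_iff] using hj
    rw [map_mul, ← IsScalarTower.algebraMap_apply, Algebra.smul_def, map_pow, map_pow,
      ← Nat.sub_add_cancel hj, pow_add, Nat.add_sub_cancel]
    have : algebraMap K⟦X⟧ L X ^ j * y ^ j = 1 := by rw [← mul_pow, hy, one_pow]
    linear_combination (algebraMap K⟦X⟧ L X ^ (m - j) * algebraMap F L (r.coeff j)) * this
  · rw [Finset.sum_range_succ, map_add, map_sum, Finset.sum_eq_zero]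
    · simp [PowerSeries.algebraMap_apply]
    · intro j hj
      have : m - j ≠ 0 := by simp at hj; omega
      simp [this]

theorem exists_X_pow_mul_aeval_mul_eq {ρ : K⟦X⟧} {x y : L} (hy : algebraMap K⟦X⟧ L X * y = 1)
    (hx : algebraMap K⟦X⟧ L X * x = algebraMap K⟦X⟧ L ρ) (i n : ℕ) {r : Polynomial F}
    (hr : ∀ j, n + 1 ≤ i + j → r.coeff j = 0) : ∃ (t : K⟦X⟧) (c : F),
      algebraMap K⟦X⟧ L (X ^ n) * (Polynomial.aeval y r * x ^ i) = algebraMap K⟦X⟧ L t ∧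
        constantCoeff t = algebraMap F K c * constantCoeff ρ ^ i ∧
        ∀ j, i + j = n → r.coeff j = c := by
  by_cases h : i ≤ n
  · have hd : r.natDegree < n - i + 1 := by
      refine Nat.lt_succ_of_le (Polynomial.natDegree_le_iff_coeff_eq_zero.mpr fun j hj ↦ hr j ?_)
      omega
    obtain ⟨t, ht, ht0⟩ := exists_X_pow_mul_aeval_eq hy hd
    refine ⟨t * ρ ^ i, r.coeff (n - i), ?_, by simp [ht0], fun j hj ↦ by congr; omega⟩
    rw [map_mul, ← ht, map_pow _ ρ, ← hx, ← Nat.sub_add_cancel h, pow_add, map_mul,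
      Nat.add_sub_cancel, map_pow _ _ i]
    ring
  · have : r = 0 := by ext j; simpa using hr j (by omega)
    exact ⟨0, 0, by simp [this], by simp, fun j hj ↦ by omega⟩

theorem eq_zero_of_mem_adjoin {k : CubicCoeffs F} (ha : k.a ≠ 0) {ρ : K⟦X⟧} {x y : L}
    (hinj : Function.Injective (algebraMap K⟦X⟧ L))
    (hρ : ∀ r₀ r₁ r₂ : F, algebraMap F K r₀ * constantCoeff ρ ^ 0 +
      algebraMap F K r₁ * constantCoeff ρ ^ 1 + algebraMap F K r₂ * constantCoeff ρ ^ 2 = 0 →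
      r₀ = 0 ∧ r₁ = 0 ∧ r₂ = 0)
    (hy : algebraMap K⟦X⟧ L X * y = 1)
    (hx : algebraMap K⟦X⟧ L X * x = algebraMap K⟦X⟧ L ρ)
    (h : (k.map (algebraMap F L)).eval ![x, y, 1] = 0) {z : L} (hz : z ∈ Algebra.adjoin F {x, y})
    {w : K⟦X⟧} (hw : z = algebraMap K⟦X⟧ L (X * w)) : z = 0 := by
  obtain ⟨r₀, r₁, r₂, e⟩ := exists_eq_of_mem_adjoin ha h hz
  have key (n : ℕ) : (∀ j, n ≤ 0 + j → r₀.coeff j = 0) → (∀ j, n ≤ 1 + j → r₁.coeff j = 0) →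
      (∀ j, n ≤ 2 + j → r₂.coeff j = 0) → z = 0 := by
    induction n with
    | zero =>
      intro h₀ h₁ h₂
      have h₀ : r₀ = 0 := by ext j; simpa using h₀ j (by omega)
      have h₁ : r₁ = 0 := by ext j; simpa using h₁ j (by omega)
      have h₂ : r₂ = 0 := by ext j; simpa using h₂ j (by omega)
      simp [e, h₀, h₁, h₂]
    | succ n ih =>
      intro h₀ h₁ h₂
      obtain ⟨t₀, c₀, e₀, d₀, g₀⟩ := exists_X_pow_mul_aeval_mul_eq hy hx 0 n h₀
      obtain ⟨t₁, c₁, e₁, d₁, g₁⟩ := exists_X_pow_mul_aeval_mul_eq hy hx 1 n h₁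
      obtain ⟨t₂, c₂, e₂, d₂, g₂⟩ := exists_X_pow_mul_aeval_mul_eq hy hx 2 n h₂
      have ht : t₀ + t₁ + t₂ = X ^ n * (X * w) := by
        apply hinj
        rw [map_add, map_add, map_mul, ← hw, e, ← e₀, ← e₁, ← e₂]
        ring
      have ht' := congrArg constantCoeff ht
      rw [map_add, map_add, d₀, d₁, d₂, map_mul, map_mul, constantCoeff_X, zero_mul, mul_zero]
        at ht'
      obtain ⟨z₀, z₁, z₂⟩ := hρ _ _ _ ht'
      refine ih (fun j hj ↦ ?_) (fun j hj ↦ ?_) (fun j hj ↦ ?_)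
      · exact hj.eq_or_lt.elim (fun hj ↦ (g₀ j hj.symm).trans z₀) (h₀ j)
      · exact hj.eq_or_lt.elim (fun hj ↦ (g₁ j hj.symm).trans z₁) (h₁ j)
      · exact hj.eq_or_lt.elim (fun hj ↦ (g₂ j hj.symm).trans z₂) (h₂ j)
  refine key (r₀.natDegree + r₁.natDegree + r₂.natDegree + 3) ?_ ?_ ?_ <;>
  · intro j hj
    apply Polynomial.coeff_eq_zero_of_natDegree_lt
    omega

end PowerSeries

section Affine

theorem tangentThird_map (φ : R →+* S) (t : Fin 3 → R) :
    (k.map φ).tangentThird (φ ∘ v) (φ ∘ t) = φ ∘ k.tangentThird v t := by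
  rw [tangentThird, eval_map, polar_map]
  ext i
  simp [tangentThird]

theorem comp_vec (φ : R →+* S) (x y z : R) : φ ∘ ![x, y, z] = ![φ x, φ y, φ z] := by
  ext i; fin_cases i <;> rfl

theorem exists_mem_polar_tangentThird_eq {p : ℕ} [Fact p.Prime] {k : CubicCoeffs (ZMod p)}
    (hk : ∀ v, k.eval v = 0 → v = 0) [Algebra (ZMod p) R] {κ : CubicCoeffs R}
    (hκ : κ = k.map (algebraMap (ZMod p) R)) {x y : R} (hP : κ.eval ![x, y, 1] = 0)
    (hQ : κ.eval ![x ^ p, y ^ p, 1] = 0) :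
    ∃ h ∈ Algebra.adjoin (ZMod p) {x, y},
      κ.polar (κ.tangentThird ![x, y, 1]
        ![-κ.polar ![x, y, 1] ![0, 1, 0], κ.polar ![x, y, 1] ![1, 0, 0], 0]) ![x ^ p, y ^ p, 1] =
      κ.polar ![x, y, 1] ![x ^ p, y ^ p, 1] ^ 2 * h := by
  let A := Algebra.adjoin (ZMod p) {x, y}
  let φ : A →+* R := A.val
  have hφ : Function.Injective φ := Subtype.val_injective
  let x₀ : A := ⟨x, Algebra.subset_adjoin (by simp)⟩
  let y₀ : A := ⟨y, Algebra.subset_adjoin (by simp)⟩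
  let k₀ := k.map (algebraMap (ZMod p) A)
  have e : κ = k₀.map φ := hκ
  have e0 : φ ∘ ![x₀, y₀, 1] = ![x, y, 1] := by simp only [comp_vec]; simp [φ, x₀, y₀]
  have e1 : φ ∘ ![x₀ ^ p, y₀ ^ p, 1] = ![x ^ p, y ^ p, 1] := by
    simp only [comp_vec]; simp [φ, x₀, y₀]
  have e2 : φ ∘ ![1, 0, 0] = ![1, 0, 0] := by simp [comp_vec]
  have e3 : φ ∘ ![0, 1, 0] = ![0, 1, 0] := by simp [comp_vec]
  rw [e, ← e0, eval_map, map_eq_zero_iff φ hφ] at hP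
  rw [e, ← e1, eval_map, map_eq_zero_iff φ hφ] at hQ
  obtain ⟨h, hh⟩ := sq_polar_dvd_of_isCoprime k₀ hP hQ (isCoprime_pow_sub hk hP)
  refine ⟨h, h.2, ?_⟩
  have := congrArg φ hh
  rw [← polar_map, ← tangentThird_map, map_mul, map_pow, ← polar_map, comp_vec φ _ _ 0, map_neg,
    ← polar_map, ← polar_map, map_zero, e0, e1, e2, e3, ← e] at this
  exact this

theorem mul_polar_tangentThird_eq {L : Type*} [Field L] {k : CubicCoeffs L} {r r' r'' s s' h : L}
    (hs : s ≠ 0) (hs' : s' ≠ 0) (hv : k.eval ![r, 1, s] = 0)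
    (hx : k.polar ![r, 1, s] ![1, 0, 0] ≠ 0) (ht : k.polar ![r, 1, s] ![r', 0, 1] = 0)
    (hh : k.polar (k.tangentThird ![r / s, s⁻¹, 1]
        ![-k.polar ![r / s, s⁻¹, 1] ![0, 1, 0], k.polar ![r / s, s⁻¹, 1] ![1, 0, 0], 0])
        ![r'' / s', s'⁻¹, 1] =
      k.polar ![r / s, s⁻¹, 1] ![r'' / s', s'⁻¹, 1] ^ 2 * h) :
    s ^ 4 * k.polar ![r, 1, s] ![r'', 1, s'] ^ 2 * h =
      k.polar ![r, 1, s] ![1, 0, 0] ^ 6 * s' *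
        k.polar (k.tangentThird ![r, 1, s] ![r', 0, 1]) ![r'', 1, s'] := by
  have hP : ![r, 1, s] = s • ![r / s, s⁻¹, 1] := by
    ext i; fin_cases i <;> simp [hs, mul_div_cancel₀]
  have hQ : ![r'', 1, s'] = s' • ![r'' / s', s'⁻¹, 1] := by
    ext i; fin_cases i <;> simp [hs', mul_div_cancel₀]
  have hE := k.polar_self ![r, 1, s]
  rw [hv] at hE
  set P := ![r / s, s⁻¹, 1] with hPdef
  set Q := ![r'' / s', s'⁻¹, 1]
  set t := ![-k.polar P ![0, 1, 0], k.polar P ![1, 0, 0], 0] with htdef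
  set U := k.polar ![r, 1, s] ![1, 0, 0] with hU
  have hU' : k.polar P ![1, 0, 0] = U / s ^ 2 := by
    rw [hU, hP, polar_smul]; field_simp
  have hV' : k.polar P ![0, 1, 0] = k.polar ![r, 1, s] ![0, 1, 0] / s ^ 2 := by
    rw [hP, polar_smul]; field_simp
  have hP0 : k.eval P = 0 := by
    rw [hP, eval_smul] at hv
    exact (mul_eq_zero.mp hv).resolve_left (pow_ne_zero 3 hs)
  have hPt : k.polar P t = 0 := by simp [htdef, polar]; ring
  have htt : ![r', 0, 1] = (1 : L) • P + (-s / U) • t := by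
    rw [htdef, hU', hV']
    ext i; fin_cases i
    · simp [hPdef]
      field_simp
      simp [hU, polar] at hE ht ⊢
      linear_combination s * ht - hE
    · simp [hPdef]
      field_simp
      ring
    · simp [hPdef]
  have h1 : k.tangentThird ![r, 1, s] ![r', 0, 1] = s • k.tangentThird P ![r', 0, 1] := by
    rw [tangentThird, tangentThird, hP, polar_smul_right]
    ext i
    simp only [Pi.add_apply, Pi.smul_apply, smul_eq_mul]
    ring
  rw [h1, k.tangentThird_comb _ _ hP0 hPt htt, polar_smul, polar_smul, hQ, polar_smul_right,
    polar_smul_right, hh, hP, polar_smul]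
  field_simp

end Affine

section Anisotropic

open PowerSeries

/-- A root of an irreducible cubic polynomial satisfies no quadratic equation. -/
theorem exists_root_of_forall_ne_zero {F : Type*} (K : Type*) [Field F] [Field K] [Algebra F K]
    [IsAlgClosed K] {a b c : F} (ha : a ≠ 0) (h : ∀ x : F, a * x ^ 3 + b * x + c ≠ 0) :
    ∃ θ : K, algebraMap F K a * θ ^ 3 + algebraMap F K b * θ + algebraMap F K c = 0 ∧
      ∀ r₀ r₁ r₂ : F, algebraMap F K r₀ * θ ^ 0 + algebraMap F K r₁ * θ ^ 1 +
        algebraMap F K r₂ * θ ^ 2 = 0 → r₀ = 0 ∧ r₁ = 0 ∧ r₂ = 0 := by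
  obtain ⟨g, hg⟩ : ∃ g, g = Cubic.toPoly ⟨a, 0, b, c⟩ := ⟨_, rfl⟩
  have hdeg : g.natDegree = 3 := hg ▸ Cubic.natDegree_of_a_ne_zero ha
  have hg0 : g ≠ 0 := by rintro rfl; simp at hdeg
  have hirr : Irreducible g := by
    refine Polynomial.irreducible_of_degree_le_three_of_not_isRoot (by simp [hdeg]) fun x hx ↦ h x ?_
    simpa [hg, Cubic.toPoly] using hx
  obtain ⟨θ, hθ⟩ := IsAlgClosed.exists_aeval_eq_zero K g (by
    rw [Polynomial.degree_eq_natDegree hg0, hdeg]; norm_num)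
  refine ⟨θ, by simpa [hg, Cubic.toPoly] using hθ, fun r₀ r₁ r₂ hr ↦ ?_⟩
  obtain ⟨r, hr'⟩ : ∃ r, r = Cubic.toPoly ⟨0, r₂, r₁, r₀⟩ := ⟨_, rfl⟩
  have hr0 : Polynomial.aeval θ r = 0 := by
    simp [hr', Cubic.toPoly]
    linear_combination hr
  have hrz : r = 0 := by
    by_contra hrz
    have := Polynomial.natDegree_le_of_dvd (minpoly.dvd F θ hr0) hrz
    rw [← minpoly.eq_of_irreducible hirr hθ, Polynomial.natDegree_mul_C (by simpa using hg0), hdeg,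
      hr', Cubic.of_a_eq_zero rfl] at this
    have h2 := Polynomial.natDegree_quadratic_le (a := r₂) (b := r₁) (c := r₀)
    dsimp only at this
    omega
  rw [hr'] at hrz
  have := Cubic.ext_iff.mp ((Cubic.toPoly_eq_zero_iff _).mp hrz)
  exact ⟨this.2.2.2, this.2.2.1, this.2.1⟩

theorem exists_eval_eq_zero {K : Type*} [Field K] {k : CubicCoeffs K} (ha : k.a ≠ 0) {θ : K}
    (h : k.eval ![θ, 1, 0] = 0) (h' : k.polar ![θ, 1, 0] ![1, 0, 0] ≠ 0) :
    ∃ ρ : K⟦X⟧, (k.map C).eval ![ρ, 1, X] = 0 ∧ constantCoeff ρ = θ := by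
  simp [eval] at h
  simp [polar] at h'
  obtain ⟨B, hB⟩ : ∃ B, B = C k.a⁻¹ * (C k.b + C k.d * X ^ 2) := ⟨_, rfl⟩
  obtain ⟨E, hE⟩ : ∃ E, E = C k.a⁻¹ * (C k.c + C k.e * X ^ 2 + C k.f * X ^ 3) := ⟨_, rfl⟩
  have ha' : C k.a * C k.a⁻¹ = 1 := by rw [← map_mul, mul_inv_cancel₀ ha, map_one]
  obtain ⟨ρ, hρ, hρ'⟩ := HenselianRing.is_henselian (I := Ideal.span {X})
    (Cubic.toPoly ⟨1, 0, B, E⟩) Cubic.monic_of_a_eq_one' (C θ)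
    (by
      rw [Ideal.mem_span_singleton, X_dvd_iff]
      simp [Cubic.toPoly, hB, hE]
      field_simp
      linear_combination h)
    (by
      refine IsUnit.map _ (isUnit_iff_constantCoeff.mpr (isUnit_iff_ne_zero.mpr fun h0 ↦ h' ?_))
      have h2 : constantCoeff (2 : K⟦X⟧) = 2 := map_ofNat _ 2
      simp [Cubic.toPoly, h2] at h0
      simp [hB] at h0
      field_simp at h0
      linear_combination h0)
  refine ⟨ρ, ?_, ?_⟩
  · simp [Cubic.toPoly, hB, hE] at hρ
    simp [eval, map]
    linear_combination C k.a * hρ - ((C k.b + C k.d * X ^ 2) * ρ +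
      (C k.c + C k.e * X ^ 2 + C k.f * X ^ 3)) * ha'
  · rw [Ideal.mem_span_singleton, X_dvd_iff] at hρ'
    simpa [sub_eq_zero] using hρ'

end Anisotropic

section Main

open PowerSeries

theorem derivation_pow_char_eq_zero {p : ℕ} [CharP R p] (D : Derivation ℤ R R) (x : R) :
    D (x ^ p) = 0 := by
  rw [D.leibniz_pow, nsmul_eq_mul, CharP.cast_eq_zero, zero_mul]

variable {p : ℕ} [Fact p.Prime]

theorem isConst_map_algebraMap [Algebra (ZMod p) R] (k : CubicCoeffs (ZMod p))
    (D : Derivation ℤ R R) : (k.map (algebraMap (ZMod p) R)).IsConst D := by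
  have h (z : ZMod p) : D (algebraMap (ZMod p) R z) = 0 := by
    obtain ⟨n, rfl⟩ := ZMod.natCast_zmod_surjective z
    rw [map_natCast, D.map_natCast]
  exact ⟨h _, h _, h _, h _, h _, h _⟩

theorem eval_pow_eq_zero [Algebra (ZMod p) R] {k : CubicCoeffs (ZMod p)} [CharP R p] {x y z : R}
    (h : (k.map (algebraMap (ZMod p) R)).eval ![x, y, z] = 0) :
    (k.map (algebraMap (ZMod p) R)).eval ![x ^ p, y ^ p, z ^ p] = 0 := by
  have e : (frobenius R p).comp (algebraMap (ZMod p) R) = algebraMap (ZMod p) R :=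
    Subsingleton.elim _ _
  have := congrArg (frobenius R p) h
  rwa [← eval_map, map_map, e, map_zero, comp_vec] at this

/-- A derivation over any base, as a derivation over `ℤ`. -/
def intDerivation {A : Type*} [CommRing A] [Algebra A R] (D : Derivation A R R) :
    Derivation ℤ R R := D.restrictScalars ℤ

/-- The tangent line at the third point of the tangent line at the generic point passes through the
image of the generic point under Frobenius. -/
theorem polar_tangentThird_eq_zero {K L : Type*} [Field K] [Algebra (ZMod p) K] [Field L]
    [Algebra (ZMod p) L] [Algebra K⟦X⟧ L] [IsScalarTower (ZMod p) K⟦X⟧ L]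
    (hinjL : Function.Injective (algebraMap K⟦X⟧ L)) (hp : 5 ≤ p) {k : CubicCoeffs (ZMod p)}
    (hk : ∀ v, k.eval v = 0 → v = 0) (ha : k.a ≠ 0) {κ : CubicCoeffs K⟦X⟧}
    (hκ : κ = k.map (algebraMap (ZMod p) K⟦X⟧)) {ρ r : K⟦X⟧}
    (hρ : ∀ r₀ r₁ r₂ : ZMod p, algebraMap (ZMod p) K r₀ * constantCoeff ρ ^ 0 +
      algebraMap (ZMod p) K r₁ * constantCoeff ρ ^ 1 +
      algebraMap (ZMod p) K r₂ * constantCoeff ρ ^ 2 = 0 → r₀ = 0 ∧ r₁ = 0 ∧ r₂ = 0)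
    (hv : κ.eval ![ρ, 1, X] = 0) (hU : κ.polar ![ρ, 1, X] ![1, 0, 0] ≠ 0)
    (hG : IsUnit (κ.polar ![ρ, 1, X] ![ρ ^ p, 1, X ^ p]))
    (ht : κ.polar ![ρ, 1, X] ![r, 0, 1] = 0) :
    κ.polar (κ.tangentThird ![ρ, 1, X] ![r, 0, 1]) ![ρ ^ p, 1, X ^ p] = 0 := by
  have := charP_of_injective_algebraMap (algebraMap (ZMod p) L).injective p
  let Φ := algebraMap K⟦X⟧ L
  have hΦX : Φ X ≠ 0 := by simpa using hinjL.ne (X_ne_zero (R := K))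
  let κL := k.map (algebraMap (ZMod p) L)
  have hκL : κ.map Φ = κL := by
    have : Φ.comp (algebraMap (ZMod p) K⟦X⟧) = algebraMap (ZMod p) L := Subsingleton.elim _ _
    rw [hκ, map_map, this]
  have hP : Φ ∘ ![ρ, 1, X] = Φ X • ![Φ ρ / Φ X, (Φ X)⁻¹, 1] := by
    ext i; fin_cases i <;> simp [hΦX, mul_div_cancel₀]
  have hvL : κL.eval ![Φ ρ / Φ X, (Φ X)⁻¹, 1] = 0 := by
    have := congrArg Φ hv
    rw [← eval_map, hκL, hP, eval_smul, map_zero] at this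
    exact (mul_eq_zero.mp this).resolve_left (pow_ne_zero 3 hΦX)
  have hvp : κL.eval ![(Φ ρ / Φ X) ^ p, (Φ X)⁻¹ ^ p, 1] = 0 := by
    simpa using eval_pow_eq_zero hvL
  obtain ⟨h, hmem, hh⟩ := exists_mem_polar_tangentThird_eq hk rfl hvL hvp
  have e1 : Φ ∘ ![1, 0, 0] = ![1, 0, 0] := by simp [comp_vec]
  have e2 : Φ ∘ ![r, 0, 1] = ![Φ r, 0, 1] := by simp [comp_vec]
  have e3 : Φ ∘ ![ρ, 1, X] = ![Φ ρ, 1, Φ X] := by simp [comp_vec]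
  have e4 : Φ ∘ ![ρ ^ p, 1, X ^ p] = ![Φ ρ ^ p, 1, Φ X ^ p] := by simp [comp_vec]
  rw [show k.map (algebraMap (ZMod p) L) = κL from rfl, div_pow, inv_pow] at hh
  have key := mul_polar_tangentThird_eq (r' := Φ r) hΦX (pow_ne_zero p hΦX)
    (by rw [← e3, ← hκL, eval_map, hv, map_zero])
    (by rw [← e3, ← e1, ← hκL, polar_map]; simpa using hinjL.ne hU)
    (by rw [← e3, ← e2, ← hκL, polar_map, ht, map_zero]) hh
  change Φ X ^ 4 * κL.polar _ _ ^ 2 * h = κL.polar _ _ ^ 6 * Φ X ^ p * κL.polar _ _ at key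
  rw [← hκL, ← e1, ← e2, ← e3, ← e4, tangentThird_map, polar_map, polar_map, polar_map] at key
  set N := κ.polar (κ.tangentThird ![ρ, 1, X] ![r, 0, 1]) ![ρ ^ p, 1, X ^ p]
  set U := κ.polar ![ρ, 1, X] ![1, 0, 0]
  obtain ⟨G, hG'⟩ := hG
  rw [← hG'] at key
  obtain ⟨q, rfl⟩ := Nat.exists_eq_add_of_le hp
  have hG1 : Φ ↑G * Φ ↑G⁻¹ = 1 := by rw [← map_mul, G.mul_inv, map_one]
  have hh0 : h = Φ (X * (X ^ q * U ^ 6 * N * (↑G⁻¹ : K⟦X⟧) ^ 2)) := by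
    refine mul_left_cancel₀ (pow_ne_zero 4 hΦX) ?_
    simp only [map_mul, map_pow]
    linear_combination Φ ↑G⁻¹ ^ 2 * key - Φ X ^ 4 * h * (Φ ↑G * Φ ↑G⁻¹ + 1) * hG1
  have hz : h = 0 := eq_zero_of_mem_adjoin ha hinjL hρ (mul_inv_cancel₀ hΦX)
    (mul_div_cancel₀ _ hΦX) hvL hmem hh0
  rw [hz, mul_zero, ← map_pow, ← map_pow, ← map_mul, ← map_mul, eq_comm,
    map_eq_zero_iff _ hinjL] at key
  exact (mul_eq_zero.mp key).resolve_left
    (mul_ne_zero (pow_ne_zero _ hU) (pow_ne_zero _ X_ne_zero))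

theorem exists_ne_zero_eval_eq_zero (hp : 5 ≤ p) (k : CubicCoeffs (ZMod p)) :
    ∃ v, v ≠ 0 ∧ k.eval v = 0 := by
  by_contra! hk
  replace hk : ∀ v, k.eval v = 0 → v = 0 := fun v hv ↦ by_contra fun h ↦ hk v h hv
  let K := AlgebraicClosure (ZMod p)
  have n2 : (2 : ZMod p) ≠ 0 := fun h ↦ by
    have := Nat.le_of_dvd (by norm_num) ((ZMod.natCast_eq_zero_iff 2 p).mp (by exact_mod_cast h))
    omega
  have n3 : (3 : ZMod p) ≠ 0 := fun h ↦ by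
    have := Nat.le_of_dvd (by norm_num) ((ZMod.natCast_eq_zero_iff 3 p).mp (by exact_mod_cast h))
    omega
  have ha : k.a ≠ 0 := fun h ↦ by simpa using congrFun (hk ![1, 0, 0] (by simp [eval, h])) 0
  have hc : k.c ≠ 0 := fun h ↦ by simpa using congrFun (hk ![0, 1, 0] (by simp [eval, h])) 1
  have hf : k.f ≠ 0 := fun h ↦ by simpa using congrFun (hk ![0, 0, 1] (by simp [eval, h])) 2
  have hcb : k.eval ![3 * k.c, -2 * k.b, 0] ≠ 0 := fun h ↦ by
    simpa [n3, hc] using congrFun (hk _ h) 0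
  have hroot (x : ZMod p) : k.a * x ^ 3 + k.b * x + k.c ≠ 0 := fun h ↦ by
    simpa using congrFun (hk ![x, 1, 0] (by simpa [eval] using h)) 1
  obtain ⟨θ, hθ, hind⟩ := exists_root_of_forall_ne_zero K ha hroot
  let k₀ := k.map (algebraMap (ZMod p) K)
  have hθ0 : k₀.eval ![θ, 1, 0] = 0 := by simpa [k₀, eval, map] using hθ
  have hθx : k₀.polar ![θ, 1, 0] ![1, 0, 0] ≠ 0 := fun h ↦ by
    have := hind k.b 0 (3 * k.a) (by
      have h3 : algebraMap (ZMod p) K 3 = 3 := map_ofNat _ 3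
      simp [k₀, polar, map] at h
      simp [h3]
      linear_combination h)
    simp [n3, ha] at this
  have hθG : k₀.polar ![θ, 1, 0] ![θ ^ p, 1, 0] ≠ 0 := fun h ↦ by
    have h1 : k₀.polar ![θ, 1, 0] ![1, 0, 0] * (θ ^ p - θ) = 0 := by
      have h2 := k₀.polar_self ![θ, 1, 0]
      rw [hθ0] at h2
      simp only [polar, Matrix.cons_val_zero, Matrix.cons_val_one, Matrix.cons_val] at h h2 ⊢
      linear_combination h - h2
    obtain ⟨z, rfl⟩ := exists_zmod_eq (sub_eq_zero.mp ((mul_eq_zero.mp h1).resolve_left hθx))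
    apply hroot z
    apply (algebraMap (ZMod p) K).injective
    simpa using hθ
  obtain ⟨ρ, hv, hρ⟩ := exists_eval_eq_zero (by simpa [k₀, map] using ha) hθ0 hθx
  let κ := k.map (algebraMap (ZMod p) K⟦X⟧)
  have hκ : k₀.map C = κ := by
    have : C.comp (algebraMap (ZMod p) K) = algebraMap (ZMod p) K⟦X⟧ := Subsingleton.elim _ _
    rw [map_map, this]
  have hκ0 : κ.map constantCoeff = k₀ := by
    have : constantCoeff.comp (algebraMap (ZMod p) K⟦X⟧) = algebraMap (ZMod p) K :=
      Subsingleton.elim _ _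
    rw [map_map, this]
  rw [hκ] at hv
  have hU : IsUnit (κ.polar ![ρ, 1, X] ![1, 0, 0]) := by
    rw [isUnit_iff_constantCoeff, ← polar_map, hκ0, comp_vec, comp_vec, isUnit_iff_ne_zero]
    simpa [hρ] using hθx
  have hG : IsUnit (κ.polar ![ρ, 1, X] ![ρ ^ p, 1, X ^ p]) := by
    rw [isUnit_iff_constantCoeff, ← polar_map, hκ0, comp_vec, comp_vec, isUnit_iff_ne_zero]
    simpa [hρ, show p ≠ 0 by omega] using hθG
  have hinj : Function.Injective (algebraMap (ZMod p) K⟦X⟧) :=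
    RingHom.injective (algebraMap (ZMod p) K⟦X⟧)
  have := charP_of_injective_algebraMap hinj p
  let D := intDerivation (derivative K)
  have hDX : D X = 1 := derivative_X
  have hconst : κ.IsConst D := isConst_map_algebraMap k D
  have hDpow (x : K⟦X⟧) : D (x ^ p) = 0 := derivation_pow_char_eq_zero D x
  have hline := fun u v ↦ mul_eq_mul_of_line κ (by simpa [κ, map] using ha)
    (by simpa [κ, map] using hc) (by simpa [κ, map] using hf) (u := u) (v := v)
    (by
      have e : ![3 * κ.c, -2 * κ.b, 0] =
          algebraMap (ZMod p) K⟦X⟧ ∘ ![3 * k.c, -2 * k.b, 0] := by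
        rw [comp_vec]
        simp [κ, map, map_ofNat]
        ring
      rwa [e, eval_map, map_ne_zero_iff _ hinj])
  refine hG.ne_zero (polar_eq_zero_of_polar_tangentThird_eq_zero _ ?_ ?_ hconst hline hDX hv
    hU.ne_zero ?_ ?_)
  · rw [← map_ofNat (algebraMap (ZMod p) K⟦X⟧) 2, map_ne_zero_iff _ hinj]
    exact n2
  · rw [← map_ofNat (algebraMap (ZMod p) K⟦X⟧) 3, map_ne_zero_iff _ hinj]
    exact n3
  · ext i; fin_cases i <;> simp [hDpow]
  have ht : κ.polar ![ρ, 1, X] ![D ρ, 0, 1] = 0 := by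
    have hD : D ∘ ![ρ, 1, X] = ![D ρ, 0, 1] := by
      ext i; fin_cases i <;> simp [hDX]
    rw [← hD, ← hconst.map_eval, hv, map_zero]
  exact polar_tangentThird_eq_zero (L := FractionRing K⟦X⟧) (IsFractionRing.injective _ _) hp hk ha
    rfl (by rwa [hρ]) hv hU.ne_zero hG ht

end Main

/-- A nontrivial zero of the cubic form can be moved to a non-singular one: if `u` is a singular zero
and `polar v u ≠ 0`, then the line through `u` and `v` meets the cubic in a point at which the
derivative in the direction of `u` does not vanish. -/
theorem exists_polar_ne_zero_of_eval_eq_zero {K : Type*} [Field K] (k : CubicCoeffs K)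
    (h3 : (3 : K) ≠ 0) (ha : k.a ≠ 0) (hc : k.c ≠ 0) (hf : k.f ≠ 0) {u : Fin 3 → K} (hu0 : u ≠ 0)
    (hu : k.eval u = 0) : ∃ v w, k.eval v = 0 ∧ k.polar v w ≠ 0 := by
  by_contra! h
  have hsing := h u
  have key (v : Fin 3 → K) : k.polar v u = 0 := by
    by_contra hv
    refine hv ?_
    have h0 : k.eval ((-k.eval v / k.polar v u) • u + (1 : K) • v) = 0 := by
      rw [eval_comb, hu, hsing v hu]
      field_simp
      ring
    have := h _ u h0
    rwa [polar_comb, polar_self, hu, tri_rotate, tri_rotate, tri_self_left, hsing v hu, mul_zero,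
      mul_zero, mul_zero, mul_zero, zero_add, zero_add, one_pow, one_mul] at this
  have k0 : u 0 = 0 := by simpa [polar, h3, ha] using key ![1, 0, 0]
  have k1 : u 1 = 0 := by simpa [polar, h3, hc, k0] using key ![0, 1, 0]
  have k2 : u 2 = 0 := by simpa [polar, h3, hf, k0, k1] using key ![0, 0, 1]
  exact hu0 (by ext i; fin_cases i <;> simpa)

theorem exists_ne_zero_eval_eq_zero_zmod_two :
    ∀ k : CubicCoeffs (ZMod 2), ∃ v, v ≠ 0 ∧ k.eval v = 0 := by
  rintro ⟨a, b, c, d, e, f⟩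
  simp only [eval]
  revert a b c d e f
  decide

end CubicCoeffs

theorem stmt_13 (p : ℕ) [Fact p.Prime] (hp3 : p ≠ 3) (a b c d e f : ZMod p)
    (hacf : a * c * f ≠ 0) :
    ∃ x y z : ZMod p,
      a * x ^ 3 + b * x * y ^ 2 + c * y ^ 3 + (d * x + e * y) * z ^ 2 + f * z ^ 3 = 0 ∧
      (3 * a * x ^ 2 + b * y ^ 2 + d * z ^ 2 ≠ 0 ∨
       2 * b * x * y + 3 * c * y ^ 2 + e * z ^ 2 ≠ 0 ∨
       2 * (d * x + e * y) * z + 3 * f * z ^ 2 ≠ 0) := by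
  have hp := Fact.out (p := p.Prime)
  let k : CubicCoeffs (ZMod p) := ⟨a, b, c, d, e, f⟩
  have h3 : (3 : ZMod p) ≠ 0 := fun h ↦ hp3 <|
    (Nat.prime_dvd_prime_iff_eq hp Nat.prime_three).mp
      ((ZMod.natCast_eq_zero_iff 3 p).mp (by exact_mod_cast h))
  obtain ⟨u, hu0, hu⟩ : ∃ u, u ≠ 0 ∧ k.eval u = 0 := by
    obtain rfl | hp2 := eq_or_ne p 2
    · exact k.exists_ne_zero_eval_eq_zero_zmod_two
    · exact k.exists_ne_zero_eval_eq_zero (hp.five_le_of_ne_two_of_ne_three hp2 hp3)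
  obtain ⟨v, w, hv, hw⟩ := k.exists_polar_ne_zero_of_eval_eq_zero h3
    (left_ne_zero_of_mul (left_ne_zero_of_mul hacf))
    (right_ne_zero_of_mul (left_ne_zero_of_mul hacf)) (right_ne_zero_of_mul hacf) hu0 hu
  refine ⟨v 0, v 1, v 2, hv, ?_⟩
  by_contra! h
  obtain ⟨h0, h1, h2⟩ := h
  exact hw (by simp [CubicCoeffs.polar, k, h0, h1, h2])
end

section
/- Let p ≠ 3 be a prime and a_1,…,a_r nonzero integers such that v_p(a_i) ≡ v_p(a_j) ≡ v_p(a_k) (mod 3) for some indices i < j < k. Then the quotient set R(C) of C(x_1,…,x_r) = a_1 x_1^3 + ⋯ + a_r x_r^3 is dense in Q_p. -/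
/-- In a finite field, the nonzero elements fall into at most three classes modulo cubes. -/
lemma exists_cubicClass (F : Type*) [Field F] [Finite F] :
    ∃ χ : F → Fin 3, ∀ x y, x ≠ 0 → y ≠ 0 → χ x = χ y → ∃ s, s ≠ 0 ∧ x = y * s ^ 3 := by
  obtain ⟨g, hg⟩ := IsCyclic.exists_zpow_surjective (G := Fˣ)
  have hlog : ∀ x : F, ∃ n : ℤ, x ≠ 0 → x = (g : F) ^ n := fun x ↦ by
    by_cases hx : x = 0
    · exact ⟨0, fun h ↦ absurd hx h⟩
    · obtain ⟨n, hn⟩ := hg (Units.mk0 x hx)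
      exact ⟨n, fun _ ↦ by simpa using congrArg Units.val hn.symm⟩
  choose n hn using hlog
  refine ⟨fun x ↦ ⟨(n x % 3).toNat, by omega⟩, fun x y hx hy h ↦ ?_⟩
  rw [Fin.mk.injEq] at h
  obtain ⟨m, hm⟩ : ∃ m, n x = n y + m * 3 := ⟨(n x - n y) / 3, by omega⟩
  refine ⟨(g : F) ^ m, zpow_ne_zero _ g.ne_zero, ?_⟩
  conv_lhs => rw [hn x hx, hm, zpow_add₀ g.ne_zero, zpow_mul]
  rw [← hn y hy]
  norm_cast

/-- A diagonal ternary cubic form over a finite field is isotropic. -/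
lemma exists_diagonal_cubic_eq_zero {F : Type*} [Field F] [Finite F] {u v w : F}
    (hu : u ≠ 0) (hv : v ≠ 0) (hw : w ≠ 0) :
    ∃ x y z : F, (x ≠ 0 ∨ y ≠ 0 ∨ z ≠ 0) ∧ u * x ^ 3 + v * y ^ 3 + w * z ^ 3 = 0 := by
  by_contra! hs
  obtain ⟨χ, hχ⟩ := exists_cubicClass F
  have huv : χ u ≠ χ v := fun h ↦ by
    obtain ⟨s, -, e⟩ := hχ u v hu hv h
    exact hs 1 (-s) 0 (by simp) (by rw [e]; ring)
  have huw : χ u ≠ χ w := fun h ↦ by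
    obtain ⟨s, -, e⟩ := hχ u w hu hw h
    exact hs 1 0 (-s) (by simp) (by rw [e]; ring)
  have hvw : χ v ≠ χ w := fun h ↦ by
    obtain ⟨s, -, e⟩ := hχ v w hv hw h
    exact hs 0 1 (-s) (by simp) (by rw [e]; ring)
  have hne : ∀ k : F, u + v * k ^ 3 ≠ 0 := fun k h ↦ hs 1 k 0 (by simp) (by linear_combination h)
  have hcases : ∀ k : F, (∃ s, s ≠ 0 ∧ u + v * k ^ 3 = u * s ^ 3) ∨
      ∃ s, s ≠ 0 ∧ u + v * k ^ 3 = v * s ^ 3 := fun k ↦ by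
    have hkw : χ (u + v * k ^ 3) ≠ χ w := fun h ↦ by
      obtain ⟨s, -, e⟩ := hχ _ w (hne k) hw h
      exact hs 1 k (-s) (by simp) (by linear_combination e)
    by_cases hku : χ (u + v * k ^ 3) = χ u
    · exact .inl (hχ _ _ (hne k) hu hku)
    · exact .inr (hχ _ _ (hne k) hv (by omega))
  let H := {h : F // ∃ s, s ≠ 0 ∧ h = s ^ 3}
  have key : ∀ h : H, ∃ h' : H, u * h' = u + v * h ∨
      (v * h = h' * (u + v * h) ∧ ∃ s, s ≠ 0 ∧ u + v * h = v * s ^ 3) := by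
    rintro ⟨_, k, hk, rfl⟩
    rcases hcases k with ⟨s, hs0, e⟩ | ⟨s, hs0, e⟩
    · exact ⟨⟨s ^ 3, s, hs0, rfl⟩, .inl e.symm⟩
    · refine ⟨⟨(k / s) ^ 3, k / s, div_ne_zero hk hs0, rfl⟩, .inr ⟨?_, s, hs0, e⟩⟩
      simp only [e]
      field_simp
  choose φ hφ using key
  have hmixed : ∀ h h' : H, u * φ h = u + v * h → v * h' = φ h' * (u + v * h') →
      (∃ s, s ≠ 0 ∧ u + v * h' = v * s ^ 3) → φ h ≠ φ h' := by
    rintro ⟨_, l, hl, rfl⟩ h' e1 e2 ⟨s, hs0, e3⟩ e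
    rw [← e] at e2
    simp only at e1
    have e4 : v ^ 2 * (l * s) ^ 3 = - u ^ 2 := by
      linear_combination (-v * l ^ 3) * e3 + (-(u + v * h')) * e1 - u * e2
    refine hs 1 (u / (v * (l * s))) 0 (by simp) ?_
    have hls : l * s ≠ 0 := mul_ne_zero hl hs0
    have e5 : v * (u / (v * (l * s))) ^ 3 = u ^ 3 / (v ^ 2 * (l * s) ^ 3) := by
      field_simp
    rw [e5, e4]
    field_simp
    ring
  have hinj : Function.Injective φ := by
    intro h h' e
    rcases hφ h with e1 | ⟨e1, e2⟩ <;> rcases hφ h' with e3 | ⟨e3, e4⟩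
    · rw [← e, e1] at e3
      exact Subtype.ext (mul_left_cancel₀ hv (by linear_combination e3))
    · exact absurd e (hmixed h h' e1 e3 e4)
    · exact absurd e.symm (hmixed h' h e3 e1 e2)
    · rw [← e] at e3
      have e5 : (u * v) * ((h : F) - h') = 0 := by
        linear_combination (u + v * h') * e1 - (u + v * h) * e3
      exact Subtype.ext (sub_eq_zero.1 ((mul_eq_zero.1 e5).resolve_left (mul_ne_zero hu hv)))
  obtain ⟨h, h1⟩ := Finite.injective_iff_surjective.1 hinj ⟨1, 1, one_ne_zero, by simp⟩
  have hh0 : (h : F) ≠ 0 := by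
    obtain ⟨_, k, hk, rfl⟩ := h
    exact pow_ne_zero _ hk
  have := hφ h
  rw [h1] at this
  rcases this with e | ⟨e, -⟩
  · exact mul_ne_zero hv hh0 (by linear_combination -e)
  · exact hu (by linear_combination -e)

section Padic

variable {p : ℕ} [Fact p.Prime]

lemma PadicInt.toZMod_eq_zero_iff {x : ℤ_[p]} : PadicInt.toZMod x = 0 ↔ ‖x‖ < 1 := by
  rw [← RingHom.mem_ker, PadicInt.ker_toZMod, IsLocalRing.mem_maximalIdeal, PadicInt.mem_nonunits]

lemma PadicInt.norm_eq_one_of_toZMod_ne_zero {x : ℤ_[p]} (h : PadicInt.toZMod x ≠ 0) :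
    ‖x‖ = 1 :=
  le_antisymm x.norm_le_one (not_lt.1 fun h' ↦ h (PadicInt.toZMod_eq_zero_iff.2 h'))

/-- For `p ≠ 3`, a root of `u X ^ 3 + c` modulo `p` that is nonzero modulo `p` lifts to `ℤ_[p]`
when `u` is a unit. -/
lemma PadicInt.exists_mul_cube_add_eq_zero (hp3 : p ≠ 3) {u c x₀ : ℤ_[p]} (hu : ‖u‖ = 1)
    (hx₀ : ‖x₀‖ = 1) (h : ‖u * x₀ ^ 3 + c‖ < 1) : ∃ x, u * x ^ 3 + c = 0 := by
  have h3 : ‖(3 : ℤ_[p])‖ = 1 := by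
    refine PadicInt.norm_eq_one_of_toZMod_ne_zero fun h0 ↦ hp3 ?_
    rw [map_ofNat] at h0
    have : ((3 : ℕ) : ZMod p) = 0 := by exact_mod_cast h0
    rw [ZMod.natCast_eq_zero_iff] at this
    exact (Nat.prime_dvd_prime_iff_eq Fact.out Nat.prime_three).1 this
  obtain ⟨x, hx, -⟩ := hensels_lemma (p := p) (R := ℤ_[p])
    (F := Polynomial.C u * Polynomial.X ^ 3 + Polynomial.C c) (a := x₀)
    (by simpa [hu, hx₀, two_add_one_eq_three, h3] using h)
  exact ⟨x, by simpa using hx⟩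

lemma PadicInt.exists_diagonal_cubic_eq (hp3 : p ≠ 3) {u v w t : ℤ_[p]} (hu : ‖u‖ = 1)
    (hv : ‖v‖ = 1) (hw : ‖w‖ = 1) (ht : ‖t‖ < 1) :
    ∃ x y z, u * x ^ 3 + v * y ^ 3 + w * z ^ 3 = t := by
  have hred : ∀ {a : ℤ_[p]}, ‖a‖ = 1 → PadicInt.toZMod a ≠ 0 := fun ha h ↦
    (PadicInt.toZMod_eq_zero_iff.1 h).ne ha
  obtain ⟨x, y, z, hne, h⟩ := exists_diagonal_cubic_eq_zero (hred hu) (hred hv) (hred hw)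
  obtain ⟨x, rfl⟩ := ZMod.ringHom_surjective (PadicInt.toZMod (p := p)) x
  obtain ⟨y, rfl⟩ := ZMod.ringHom_surjective (PadicInt.toZMod (p := p)) y
  obtain ⟨z, rfl⟩ := ZMod.ringHom_surjective (PadicInt.toZMod (p := p)) z
  rw [← PadicInt.toZMod_eq_zero_iff] at ht
  rcases hne with hx | hx | hx
  · obtain ⟨s, hs⟩ := PadicInt.exists_mul_cube_add_eq_zero hp3 hu
      (PadicInt.norm_eq_one_of_toZMod_ne_zero hx) (c := v * y ^ 3 + w * z ^ 3 - t)
      (PadicInt.toZMod_eq_zero_iff.1 <| by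
        simp only [map_add, map_sub, map_mul, map_pow, ht]
        linear_combination h)
    exact ⟨s, y, z, by linear_combination hs⟩
  · obtain ⟨s, hs⟩ := PadicInt.exists_mul_cube_add_eq_zero hp3 hv
      (PadicInt.norm_eq_one_of_toZMod_ne_zero hx) (c := u * x ^ 3 + w * z ^ 3 - t)
      (PadicInt.toZMod_eq_zero_iff.1 <| by
        simp only [map_add, map_sub, map_mul, map_pow, ht]
        linear_combination h)
    exact ⟨x, s, z, by linear_combination hs⟩
  · obtain ⟨s, hs⟩ := PadicInt.exists_mul_cube_add_eq_zero hp3 hw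
      (PadicInt.norm_eq_one_of_toZMod_ne_zero hx) (c := u * x ^ 3 + v * y ^ 3 - t)
      (PadicInt.toZMod_eq_zero_iff.1 <| by
        simp only [map_add, map_sub, map_mul, map_pow, ht]
        linear_combination h)
    exact ⟨x, y, s, by linear_combination hs⟩

lemma Padic.exists_eq_zpow_valuation_mul {a : ℚ_[p]} (ha : a ≠ 0) :
    ∃ u : ℤ_[p], ‖u‖ = 1 ∧ a = (p : ℚ_[p]) ^ a.valuation * u := by
  have hp : (p : ℚ_[p]) ≠ 0 := by exact_mod_cast (Fact.out : p.Prime).ne_zero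
  have hpR : (p : ℝ) ≠ 0 := by exact_mod_cast (Fact.out : p.Prime).ne_zero
  have hnorm : ‖(p : ℚ_[p]) ^ (-a.valuation) * a‖ = 1 := by
    rw [norm_mul, Padic.norm_p_zpow, Padic.norm_eq_zpow_neg_valuation ha, ← zpow_add₀ hpR]
    simp
  refine ⟨⟨_, hnorm.le⟩, hnorm, ?_⟩
  rw [← mul_assoc, ← zpow_add₀ hp]
  simp

/-- For `p ≠ 3`, a diagonal ternary cubic form over `ℚ_[p]` whose coefficients have congruent
valuations modulo `3` is universal. -/
lemma Padic.exists_diagonal_cubic_eq (hp3 : p ≠ 3) {a b c : ℚ_[p]} (ha : a ≠ 0) (hb : b ≠ 0)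
    (hc : c ≠ 0) (hab : a.valuation ≡ b.valuation [ZMOD 3])
    (hbc : b.valuation ≡ c.valuation [ZMOD 3]) (t : ℚ_[p]) :
    ∃ x y z, a * x ^ 3 + b * y ^ 3 + c * z ^ 3 = t := by
  have hp : (p : ℚ_[p]) ≠ 0 := by exact_mod_cast (Fact.out : p.Prime).ne_zero
  obtain ⟨u, hu, eu⟩ := Padic.exists_eq_zpow_valuation_mul ha
  obtain ⟨v, hv, ev⟩ := Padic.exists_eq_zpow_valuation_mul hb
  obtain ⟨w, hw, ew⟩ := Padic.exists_eq_zpow_valuation_mul hc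
  obtain ⟨m, hm⟩ : ∃ m, b.valuation = a.valuation + m * 3 := by
    obtain ⟨m, hm⟩ := hab.dvd
    exact ⟨m, by omega⟩
  obtain ⟨n, hn⟩ : ∃ n, c.valuation = a.valuation + n * 3 := by
    obtain ⟨n, hn⟩ := (hab.trans hbc).dvd
    exact ⟨n, by omega⟩
  rw [hm, zpow_add₀ hp, zpow_mul] at ev
  rw [hn, zpow_add₀ hp, zpow_mul] at ew
  set P : ℚ_[p] := (p : ℚ_[p]) ^ a.valuation
  have hP : P ≠ 0 := zpow_ne_zero _ hp
  obtain ⟨N, hN⟩ : ∃ N : ℕ, ‖t / P * ((p : ℚ_[p]) ^ N) ^ 3‖ < 1 := by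
    have hlim : Filter.Tendsto (fun N : ℕ ↦ ‖t / P * ((p : ℚ_[p]) ^ N) ^ 3‖) Filter.atTop
        (nhds ‖t / P * 0 ^ 3‖) :=
      (((tendsto_pow_atTop_nhds_zero_of_norm_lt_one Padic.norm_p_lt_one).pow 3).const_mul _).norm
    exact (hlim.eventually (gt_mem_nhds (by simp))).exists
  obtain ⟨x, y, z, h⟩ := PadicInt.exists_diagonal_cubic_eq hp3 hu hv hw
    (t := ⟨t / P * ((p : ℚ_[p]) ^ N) ^ 3, hN.le⟩) hN
  have h' : (u : ℚ_[p]) * x ^ 3 + v * y ^ 3 + w * z ^ 3 = t / P * ((p : ℚ_[p]) ^ N) ^ 3 := by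
    exact_mod_cast congrArg ((↑) : ℤ_[p] → ℚ_[p]) h
  have hQ : (p : ℚ_[p]) ^ N ≠ 0 := pow_ne_zero _ hp
  have hM : (p : ℚ_[p]) ^ m ≠ 0 := zpow_ne_zero _ hp
  have hL : (p : ℚ_[p]) ^ n ≠ 0 := zpow_ne_zero _ hp
  refine ⟨x / p ^ N, y / (p ^ m * p ^ N), z / (p ^ n * p ^ N), ?_⟩
  rw [eu, ev, ew]
  generalize (p : ℚ_[p]) ^ N = Q at *
  generalize (p : ℚ_[p]) ^ m = M at *
  generalize (p : ℚ_[p]) ^ n = L at *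
  have e : t = P * ((u : ℚ_[p]) * x ^ 3 + v * y ^ 3 + w * z ^ 3) / Q ^ 3 := by
    rw [h']
    field_simp
  rw [e]
  field_simp

end Padic

/-- A diagonal cubic form with integer coefficients that is universal over `ℚ_[p]` has dense
quotient set. -/
lemma dense_quotients_of_universal {p : ℕ} [Fact p.Prime] {r : ℕ} {a : Fin r → ℤ} {i : Fin r}
    (hi : a i ≠ 0) (h : ∀ t : ℚ_[p], ∃ x : Fin r → ℚ_[p], ∑ j, (a j : ℚ_[p]) * x j ^ 3 = t) :
    Dense {q : ℚ_[p] | ∃ x y : Fin r → ℤ,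
      (∑ i, a i * (y i) ^ 3) ≠ 0 ∧
      q = ((∑ i, a i * (x i) ^ 3 : ℤ) : ℚ_[p]) / ((∑ i, a i * (y i) ^ 3 : ℤ) : ℚ_[p])} := by
  have hi' : (a i : ℚ_[p]) ≠ 0 := by exact_mod_cast hi
  let f : (Fin r → ℚ_[p]) → ℚ_[p] := fun x ↦ (∑ j, (a j : ℚ_[p]) * x j ^ 3) / a i
  have hf : Continuous f := by fun_prop
  have hsurj : Function.Surjective f := fun q ↦ by
    obtain ⟨x, hx⟩ := h (q * a i)
    exact ⟨x, by simp only [f, hx]; field_simp⟩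
  have hdense : DenseRange (Pi.map fun _ : Fin r ↦ ((↑) : ℚ → ℚ_[p])) :=
    DenseRange.piMap fun _ ↦ Padic.denseRange_ratCast p
  refine (hsurj.denseRange.comp hdense hf).mono ?_
  rintro _ ⟨x, rfl⟩
  obtain ⟨b, hb⟩ := IsLocalization.exist_integer_multiples_of_finite (nonZeroDivisors ℤ) x
  choose X hX using hb
  have hb0 : (b : ℤ) ≠ 0 := nonZeroDivisors.ne_zero b.2
  have hb1 : ((b : ℤ) : ℚ_[p]) ≠ 0 := by exact_mod_cast hb0
  have hX' : ∀ j, (X j : ℚ_[p]) = (b : ℤ) * (x j : ℚ_[p]) := fun j ↦ by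
    have := hX j
    simp only [algebraMap_int_eq, eq_intCast, zsmul_eq_mul] at this
    exact_mod_cast congrArg ((↑) : ℚ → ℚ_[p]) this
  have hY : ∑ j, a j * (Pi.single i (b : ℤ) : Fin r → ℤ) j ^ 3 = a i * (b : ℤ) ^ 3 := by
    rw [Finset.sum_eq_single i] <;> simp +contextual
  refine ⟨X, Pi.single i b, ?_, ?_⟩
  · rw [hY]
    exact mul_ne_zero hi (pow_ne_zero _ hb0)
  · rw [hY]
    push_cast
    simp only [f, Function.comp, Pi.map_apply, hX', mul_pow]
    simp only [mul_left_comm _ (((b : ℤ) : ℚ_[p]) ^ 3), ← Finset.mul_sum]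
    field_simp


theorem stmt_14 (p : ℕ) [Fact p.Prime] (hp3 : p ≠ 3) (r : ℕ) (a : Fin r → ℤ)
    (ha : ∀ i, a i ≠ 0)
    (hval : ∃ i j k : Fin r, i < j ∧ j < k ∧
      (padicValInt p (a i) : ℤ) ≡ (padicValInt p (a j) : ℤ) [ZMOD (3 : ℤ)] ∧
      (padicValInt p (a j) : ℤ) ≡ (padicValInt p (a k) : ℤ) [ZMOD (3 : ℤ)]) :
    Dense {q : ℚ_[p] | ∃ x y : Fin r → ℤ,
      (∑ i, a i * (y i) ^ 3) ≠ 0 ∧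
      q = ((∑ i, a i * (x i) ^ 3 : ℤ) : ℚ_[p]) / ((∑ i, a i * (y i) ^ 3 : ℤ) : ℚ_[p])} := by
  obtain ⟨i, j, k, hij, hjk, h1, h2⟩ := hval
  refine dense_quotients_of_universal (ha i) fun t ↦ ?_
  have ha' : ∀ l, (a l : ℚ_[p]) ≠ 0 := fun l ↦ by exact_mod_cast ha l
  obtain ⟨x, y, z, h⟩ := Padic.exists_diagonal_cubic_eq hp3 (ha' i) (ha' j) (ha' k)
    (by simpa only [Padic.valuation_intCast] using h1)
    (by simpa only [Padic.valuation_intCast] using h2) t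
  have hik := hij.trans hjk
  refine ⟨fun l ↦ if l = i then x else if l = j then y else if l = k then z else 0, ?_⟩
  rw [← h, ← Finset.sum_subset (Finset.subset_univ {i, j, k})]
  · rw [Finset.sum_insert (by simp [hij.ne, hik.ne]), Finset.sum_insert (by simp [hjk.ne]),
      Finset.sum_singleton]
    simp [hij.ne', hik.ne', hjk.ne', add_assoc]
  · intro l _ hl
    simp only [Finset.mem_insert, Finset.mem_singleton, not_or] at hl
    simp [hl]
end

section
/- Let p ≠ 3 be a prime and C(x_1,…,x_r) = a_1 x_1^3 + ⋯ + a_r x_r^3 with all a_i nonzero integers and r ≥ 7. Then the quotient set R(C) is dense in Q_p. -/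
theorem FiniteField.exists_cube_mul_of_not_cube {K : Type*} [Field K] [Finite K] {g : K}
    (hg : ∀ u : K, u ^ 3 ≠ g) {t : K} (ht : t ≠ 0) :
    ∃ u : K, u ≠ 0 ∧ (t = u ^ 3 ∨ t = g * u ^ 3 ∨ t = g ^ 2 * u ^ 3) := by
  obtain ⟨z, hz⟩ := IsCyclic.exists_generator (α := Kˣ)
  have key : ∀ s : K, s ≠ 0 → ∃ u : K, u ≠ 0 ∧
      (s = u ^ 3 ∨ s = z * u ^ 3 ∨ s = (z : K) ^ 2 * u ^ 3) := by
    intro s hs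
    obtain ⟨n, hn⟩ := Subgroup.mem_zpowers_iff.1 (hz (Units.mk0 s hs))
    have hn' : (z : K) ^ n = s := by
      have := congrArg (Units.val) hn
      simpa using this
    have hz0 : (z : K) ≠ 0 := z.ne_zero
    refine ⟨(z : K) ^ (n / 3), zpow_ne_zero _ hz0, ?_⟩
    have h3 : (((z : K) ^ (n / 3)) ^ 3 : K) = (z : K) ^ (3 * (n / 3)) := by
      rw [← zpow_natCast, ← zpow_mul, mul_comm]; rfl
    rw [h3, ← hn']
    have : n % 3 = 0 ∨ n % 3 = 1 ∨ n % 3 = 2 := by omega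
    rcases this with h | h | h
    · left; congr 1; omega
    · right; left
      rw [← zpow_one_add₀ hz0]; congr 1; omega
    · right; right
      rw [← zpow_natCast, ← zpow_add₀ hz0]; congr 1; push_cast; omega
  have hg0 : g ≠ 0 := fun h => hg 0 (by simp [h])
  have hz0 : (z : K) ≠ 0 := z.ne_zero
  obtain ⟨u, hu, h1⟩ := key t ht
  obtain ⟨v, hv, h2⟩ := key g hg0
  rcases h2 with rfl | rfl | rfl
  · exact absurd rfl (hg v)
  · rcases h1 with rfl | rfl | rfl
    · exact ⟨u, hu, Or.inl rfl⟩
    · exact ⟨u / v, div_ne_zero hu hv, Or.inr <| Or.inl <| by field_simp⟩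
    · exact ⟨u / v ^ 2, div_ne_zero hu (pow_ne_zero _ hv), Or.inr <| Or.inr <| by field_simp⟩
  · rcases h1 with rfl | rfl | rfl
    · exact ⟨u, hu, Or.inl rfl⟩
    · exact ⟨u / (v ^ 2 * z), div_ne_zero hu (mul_ne_zero (pow_ne_zero _ hv) hz0),
        Or.inr <| Or.inr <| by field_simp⟩
    · exact ⟨u / v, div_ne_zero hu hv, Or.inr <| Or.inl <| by field_simp⟩

theorem FiniteField.exists_add_mul_cube_add_sq_mul_cube_eq_zero {K : Type*} [Field K] [Finite K]
    {g : K} (hg : ∀ u : K, u ^ 3 ≠ g) :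
    ∃ x y z : K, x ≠ 0 ∧ x ^ 3 + g * y ^ 3 + g ^ 2 * z ^ 3 = 0 := by
  by_contra! hno
  have hg0 : g ≠ 0 := fun h => hg 0 (by simp [h])
  let H : Set K := {x | x ≠ 0 ∧ ∃ u, u ^ 3 = x}
  have hmulH : ∀ x ∈ H, ∀ y ∈ H, g * x ≠ g ^ 2 * y := by
    rintro _ ⟨hx, u, rfl⟩ _ ⟨hy, v, rfl⟩ h
    have hv : v ≠ 0 := by rintro rfl; simp at hy
    apply hg (u / v)
    field_simp
    apply mul_left_cancel₀ hg0
    linear_combination h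
  have hsum : ∀ x ∈ H, ∀ y ∈ H, x + g * y ∉ H → g ^ 2 * (x + g * y) ∈ H := by
    rintro _ ⟨hx, u, rfl⟩ _ ⟨hy, v, rfl⟩ h
    have hu : u ≠ 0 := by rintro rfl; simp at hx
    have h0 : u ^ 3 + g * v ^ 3 ≠ 0 := by
      intro h; exact hno u v 0 hu (by linear_combination h)
    obtain ⟨w, hw, h1 | h1 | h1⟩ := exists_cube_mul_of_not_cube hg h0
    · exact absurd ⟨h0, w, h1.symm⟩ h
    · exact ⟨mul_ne_zero (pow_ne_zero _ hg0) h0, g * w, by rw [h1]; ring⟩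
    · exact absurd (by rw [h1]; ring) (hno u v (-w) hu)
  have hneg : ∀ x ∈ H, -x ∈ H := by
    rintro _ ⟨hx, u, rfl⟩
    exact ⟨neg_ne_zero.2 hx, -u, by ring⟩
  have hg3 : ∀ x ∈ H, g ^ 3 * x ∈ H := by
    rintro _ ⟨hx, u, rfl⟩
    exact ⟨mul_ne_zero (pow_ne_zero _ hg0) hx, g * u, by ring⟩
  classical
  let f : H × H → H × H := fun w =>
    if h : (w.1 : K) + g * w.2 ∈ H then (⟨_, h⟩, ⟨_, hneg _ w.1.2⟩)
    else (⟨_, hsum _ w.1.2 _ w.2.2 h⟩, ⟨_, hneg _ (hg3 _ w.2.2)⟩)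
  have hf : ∀ w : H × H, ((f w).1 : K) + (f w).2 = g * w.2 ∧ (f w).2.1 = - w.1.1 ∨
      ((f w).1 : K) + (f w).2 = g ^ 2 * w.1 ∧ (f w).2.1 = - (g ^ 3 * w.2.1) := by
    intro w
    by_cases h : (w.1 : K) + g * w.2 ∈ H
    · left
      simp only [f, dif_pos h, and_true]
      ring
    · right
      simp only [f, dif_neg h, and_true]
      ring
  have hinj : Function.Injective f := by
    intro w w' h
    have e1 := hf w
    have e2 := hf w'
    rw [← h] at e2
    rcases e1 with ⟨a1, b1⟩ | ⟨a1, b1⟩ <;> rcases e2 with ⟨a2, b2⟩ | ⟨a2, b2⟩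
    · refine Prod.ext (Subtype.ext (neg_injective (b1.symm.trans b2)))
        (Subtype.ext (mul_left_cancel₀ hg0 (a1.symm.trans a2)))
    · exact absurd (a1.symm.trans a2) (hmulH _ w.2.2 _ w'.1.2)
    · exact absurd (a2.symm.trans a1) (hmulH _ w'.2.2 _ w.1.2)
    · refine Prod.ext (Subtype.ext (mul_left_cancel₀ (pow_ne_zero 2 hg0) (a1.symm.trans a2)))
        (Subtype.ext (mul_left_cancel₀ (pow_ne_zero 3 hg0) (neg_injective (b1.symm.trans b2))))
  have h1 : (1 : K) ∈ H := ⟨one_ne_zero, 1, one_pow 3⟩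
  obtain ⟨w, hw⟩ := Finite.surjective_of_injective hinj (⟨1, h1⟩, ⟨-1, hneg 1 h1⟩)
  have h2 := hf w
  rw [hw] at h2
  rcases h2 with ⟨h2, -⟩ | ⟨h2, -⟩
  · exact mul_ne_zero hg0 w.2.2.1 (by rw [← h2]; simp)
  · exact mul_ne_zero (pow_ne_zero 2 hg0) w.1.2.1 (by rw [← h2]; simp)

theorem FiniteField.exists_diagonal_ternary_cubic_eq_zero {K : Type*} [Field K] [Finite K]
    {a b c : K} (ha : a ≠ 0) (hb : b ≠ 0) (hc : c ≠ 0) :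
    ∃ x y z : K, (x ≠ 0 ∨ y ≠ 0) ∧ a * x ^ 3 + b * y ^ 3 + c * z ^ 3 = 0 := by
  by_cases hg : ∃ u : K, u ^ 3 = b / a
  · obtain ⟨u, hu⟩ := hg
    refine ⟨-u, 1, 0, Or.inr one_ne_zero, ?_⟩
    have : (-u) ^ 3 = -(b / a) := by rw [← hu]; ring
    rw [this]; field_simp; ring
  · push Not at hg
    obtain ⟨u, hu, h | h | h⟩ := exists_cube_mul_of_not_cube hg (div_ne_zero hc ha)
    · refine ⟨-u, 0, 1, Or.inl (neg_ne_zero.2 hu), ?_⟩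
      have : (-u) ^ 3 = -(c / a) := by rw [h]; ring
      rw [this]; field_simp; ring
    · refine ⟨0, -u, 1, Or.inr (neg_ne_zero.2 hu), ?_⟩
      have : c = b * u ^ 3 := by field_simp at h; exact h
      rw [this]; ring
    · obtain ⟨x, y, z, hx, h0⟩ := exists_add_mul_cube_add_sq_mul_cube_eq_zero hg
      refine ⟨x, y, z / u, Or.inl hx, ?_⟩
      have e1 : b = a * (b / a) := by field_simp
      have e2 : c * (z / u) ^ 3 = a * ((b / a) ^ 2 * z ^ 3) := by
        have : c = a * ((b / a) ^ 2 * u ^ 3) := by rw [← h]; field_simp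
        rw [this]; field_simp
      rw [e2]
      nth_rewrite 1 [e1]
      linear_combination a * h0

theorem PadicInt.toZMod_eq_zero_iff_norm_lt_one {p : ℕ} [Fact p.Prime] {x : ℤ_[p]} :
    PadicInt.toZMod x = 0 ↔ ‖x‖ < 1 := by
  rw [← RingHom.mem_ker, PadicInt.ker_toZMod, IsLocalRing.mem_maximalIdeal, PadicInt.mem_nonunits]

theorem PadicInt.exists_mul_cube_eq {p : ℕ} [Fact p.Prime] (hp3 : p ≠ 3) {a c x₀ : ℤ_[p]}
    (ha : PadicInt.toZMod a ≠ 0) (hx₀ : PadicInt.toZMod x₀ ≠ 0)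
    (h : PadicInt.toZMod (a * x₀ ^ 3) = PadicInt.toZMod c) : ∃ x : ℤ_[p], a * x ^ 3 = c := by
  let F : Polynomial ℤ_[p] := Polynomial.C a * Polynomial.X ^ 3 - Polynomial.C c
  have hF : ∀ x : ℤ_[p], Polynomial.aeval x F = a * x ^ 3 - c := by intro x; simp [F]
  have hF' : Polynomial.aeval x₀ F.derivative = a * (3 * x₀ ^ 2) := by
    simp [F]
    norm_num
  have h3 : (3 : ZMod p) ≠ 0 := by
    intro h0
    have : ((3 : ℕ) : ZMod p) = 0 := by exact_mod_cast h0
    rw [ZMod.natCast_eq_zero_iff] at this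
    exact hp3 ((Nat.prime_dvd_prime_iff_eq Fact.out Nat.prime_three).1 this)
  have hunit : ‖Polynomial.aeval x₀ F.derivative‖ = 1 := by
    refine le_antisymm (PadicInt.norm_le_one _) (not_lt.1 fun hlt => ?_)
    rw [← PadicInt.toZMod_eq_zero_iff_norm_lt_one, hF', map_mul, map_mul, map_pow,
      map_ofNat] at hlt
    exact mul_ne_zero ha (mul_ne_zero h3 (pow_ne_zero 2 hx₀)) hlt
  obtain ⟨x, hx, -⟩ := hensels_lemma (F := F) (a := x₀) (by
    rw [hunit, one_pow, ← PadicInt.toZMod_eq_zero_iff_norm_lt_one, hF, map_sub, h, sub_self])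
  exact ⟨x, sub_eq_zero.1 ((hF x).symm.trans hx)⟩

theorem PadicInt.exists_diagonal_ternary_cubic_eq {p : ℕ} [Fact p.Prime] (hp3 : p ≠ 3)
    {a b c : ℤ_[p]} (ha : ‖a‖ = 1) (hb : ‖b‖ = 1) (hc : ‖c‖ = 1) {n : ℤ_[p]} (hn : ‖n‖ < 1) :
    ∃ x y z : ℤ_[p], a * x ^ 3 + b * y ^ 3 + c * z ^ 3 = n := by
  have hne : ∀ {u : ℤ_[p]}, ‖u‖ = 1 → PadicInt.toZMod u ≠ 0 := fun hu h =>
    (PadicInt.toZMod_eq_zero_iff_norm_lt_one.1 h).ne hu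
  obtain ⟨x, y, z, hxy, h⟩ :=
    FiniteField.exists_diagonal_ternary_cubic_eq_zero (hne ha) (hne hb) (hne hc)
  have hsurj := ZMod.ringHom_surjective (PadicInt.toZMod (p := p))
  obtain ⟨x, rfl⟩ := hsurj x
  obtain ⟨y, rfl⟩ := hsurj y
  obtain ⟨z, rfl⟩ := hsurj z
  have hn0 := PadicInt.toZMod_eq_zero_iff_norm_lt_one.2 hn
  rcases hxy with hx | hy
  · obtain ⟨x', hx'⟩ := PadicInt.exists_mul_cube_eq hp3 (hne ha) hx
      (c := n - b * y ^ 3 - c * z ^ 3) (by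
        simp only [map_mul, map_sub, map_pow, hn0]; linear_combination h)
    exact ⟨x', y, z, by rw [hx']; ring⟩
  · obtain ⟨y', hy'⟩ := PadicInt.exists_mul_cube_eq hp3 (hne hb) hy
      (c := n - a * x ^ 3 - c * z ^ 3) (by
        simp only [map_mul, map_sub, map_pow, hn0]; linear_combination h)
    exact ⟨x, y', z, by rw [hy']; ring⟩

theorem Padic.exists_unit_mul_zpow_mul_cube {p : ℕ} [Fact p.Prime] {b : ℚ_[p]} (hb : b ≠ 0)
    {v : ℤ} (hv : b.valuation ≡ v [ZMOD 3]) :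
    ∃ (u : ℤ_[p]) (t : ℚ_[p]), ‖u‖ = 1 ∧ t ≠ 0 ∧ b * t ^ 3 = (p : ℚ_[p]) ^ v * u := by
  have hp0 : (p : ℚ_[p]) ≠ 0 := by exact_mod_cast (Fact.out : p.Prime).ne_zero
  have hpR : (p : ℝ) ≠ 0 := by exact_mod_cast (Fact.out : p.Prime).ne_zero
  obtain ⟨k, hk⟩ := hv.dvd
  have hnorm : ‖b * (p : ℚ_[p]) ^ (-b.valuation)‖ = 1 := by
    rw [norm_mul, Padic.norm_eq_zpow_neg_valuation hb, Padic.norm_p_zpow, ← zpow_add₀ hpR]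
    simp
  refine ⟨⟨_, hnorm.le⟩, (p : ℚ_[p]) ^ k, hnorm, zpow_ne_zero _ hp0, ?_⟩
  rw [← zpow_natCast, ← zpow_mul, mul_left_comm, ← zpow_add₀ hp0]
  congr 2
  push_cast
  lia

theorem Padic.exists_diagonal_ternary_cubic_eq {p : ℕ} [Fact p.Prime] (hp3 : p ≠ 3)
    {a b c : ℚ_[p]} (ha : a ≠ 0) (hb : b ≠ 0) (hc : c ≠ 0)
    (hab : b.valuation ≡ a.valuation [ZMOD 3]) (hac : c.valuation ≡ a.valuation [ZMOD 3])
    (q : ℚ_[p]) : ∃ x y z : ℚ_[p], a * x ^ 3 + b * y ^ 3 + c * z ^ 3 = q := by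
  have hp0 : (p : ℚ_[p]) ≠ 0 := by exact_mod_cast (Fact.out : p.Prime).ne_zero
  obtain ⟨u₁, t₁, hu₁, -, h₁⟩ := Padic.exists_unit_mul_zpow_mul_cube ha (Int.ModEq.refl _)
  obtain ⟨u₂, t₂, hu₂, -, h₂⟩ := Padic.exists_unit_mul_zpow_mul_cube hb hab
  obtain ⟨u₃, t₃, hu₃, -, h₃⟩ := Padic.exists_unit_mul_zpow_mul_cube hc hac
  generalize a.valuation = v at h₁ h₂ h₃
  have hlim : Filter.Tendsto (fun N : ℕ => q * (p : ℚ_[p]) ^ (-v) * ((p : ℚ_[p]) ^ 3) ^ N)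
      Filter.atTop (nhds 0) := by
    rw [← mul_zero (q * (p : ℚ_[p]) ^ (-v))]
    refine (tendsto_pow_atTop_nhds_zero_of_norm_lt_one ?_).const_mul _
    rw [norm_pow]
    exact pow_lt_one₀ (norm_nonneg _) Padic.norm_p_lt_one three_ne_zero
  obtain ⟨N, hN⟩ := ((Metric.tendsto_nhds.1 hlim) 1 one_pos).exists
  rw [dist_zero_right] at hN
  obtain ⟨x, y, z, h⟩ := PadicInt.exists_diagonal_ternary_cubic_eq hp3 hu₁ hu₂ hu₃
    (n := ⟨_, hN.le⟩) hN
  have h' := congrArg (Subtype.val) h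
  simp only [PadicInt.coe_add, PadicInt.coe_mul, PadicInt.coe_pow] at h'
  refine ⟨t₁ * x / (p : ℚ_[p]) ^ N, t₂ * y / (p : ℚ_[p]) ^ N, t₃ * z / (p : ℚ_[p]) ^ N, ?_⟩
  have hpv := zpow_ne_zero v hp0
  rw [zpow_neg] at h'
  field_simp at h' ⊢
  linear_combination (x : ℚ_[p]) ^ 3 * h₁ + (y : ℚ_[p]) ^ 3 * h₂ + (z : ℚ_[p]) ^ 3 * h₃ + h'

theorem Padic.surjective_diagonal_cubic {p : ℕ} [Fact p.Prime] (hp3 : p ≠ 3) {r : ℕ}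
    (hr : 7 ≤ r) {a : Fin r → ℚ_[p]} (ha : ∀ i, a i ≠ 0) :
    Function.Surjective fun x : Fin r → ℚ_[p] => ∑ i, a i * x i ^ 3 := by
  intro q
  obtain ⟨m, -, hm⟩ := Finset.exists_lt_card_fiber_of_mul_lt_card_of_maps_to
    (s := (Finset.univ : Finset (Fin r))) (t := Finset.Ico (0 : ℤ) 3)
    (f := fun i => (a i).valuation % 3) (n := 2) (by intro i _; simp; lia) (by simp; lia)
  obtain ⟨i, hi, j, hj, k, hk, hij, hik, hjk⟩ := Finset.two_lt_card.1 hm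
  simp only [Finset.mem_filter, Finset.mem_univ, true_and] at hi hj hk
  obtain ⟨x, y, z, h⟩ := Padic.exists_diagonal_ternary_cubic_eq hp3 (ha i) (ha j) (ha k)
    (hj.trans hi.symm) (hk.trans hi.symm) q
  refine ⟨fun l => if l = i then x else if l = j then y else if l = k then z else 0, ?_⟩
  rw [← h]
  beta_reduce
  rw [← Finset.sum_subset (Finset.subset_univ {i, j, k})]
  · rw [Finset.sum_insert (by simp [hij, hik]), Finset.sum_insert (by simp [hjk]),
      Finset.sum_singleton]
    simp [hij.symm, hik.symm, hjk.symm, add_assoc]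
  · intro l _ hl
    simp only [Finset.mem_insert, Finset.mem_singleton, not_or] at hl
    simp [hl]

theorem stmt_15 (p : ℕ) [Fact p.Prime] (hp3 : p ≠ 3) (r : ℕ) (hr : 7 ≤ r)
    (a : Fin r → ℤ) (ha : ∀ i, a i ≠ 0) :
    Dense {q : ℚ_[p] | ∃ x y : Fin r → ℤ,
      (∑ i, a i * (y i) ^ 3) ≠ 0 ∧
      q = ((∑ i, a i * (x i) ^ 3 : ℤ) : ℚ_[p]) / ((∑ i, a i * (y i) ^ 3 : ℤ) : ℚ_[p])} := by
  have ha' : ∀ i, (a i : ℚ_[p]) ≠ 0 := fun i => Int.cast_ne_zero.2 (ha i)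
  let i₀ : Fin r := ⟨0, by lia⟩
  let f : (Fin r → ℚ_[p]) → ℚ_[p] := fun x => (∑ i, (a i : ℚ_[p]) * x i ^ 3) / a i₀
  have hf : Function.Surjective f := fun q => by
    obtain ⟨x, hx⟩ := Padic.surjective_diagonal_cubic hp3 hr ha' (q * a i₀)
    exact ⟨x, (div_eq_iff (ha' i₀)).2 hx⟩
  have hdense := hf.denseRange.comp
    (DenseRange.piMap fun _ : Fin r => Padic.denseRange_ratCast p) (by fun_prop)
  refine Dense.mono ?_ hdense
  rintro _ ⟨x, rfl⟩
  obtain ⟨⟨N, hN⟩, hX⟩ := IsLocalization.exist_integer_multiples_of_finite (nonZeroDivisors ℤ) x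
  choose X hX using hX
  have hN0 : N ≠ 0 := nonZeroDivisors.ne_zero hN
  have hNp : (N : ℚ_[p]) ≠ 0 := Int.cast_ne_zero.2 hN0
  have hX' : ∀ i, (X i : ℚ_[p]) = N * (x i : ℚ_[p]) := by
    intro i
    have h := hX i
    simp only [algebraMap_int_eq, eq_intCast, zsmul_eq_mul] at h
    exact_mod_cast congrArg (Rat.cast : ℚ → ℚ_[p]) h
  have hY : ∑ i, a i * (Pi.single i₀ N : Fin r → ℤ) i ^ 3 = a i₀ * N ^ 3 := by
    rw [Finset.sum_eq_single i₀ (by intro i _ hi; simp [Pi.single_eq_of_ne hi]) (by simp)]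
    simp
  refine ⟨X, Pi.single i₀ N, ?_, ?_⟩
  · rw [hY]
    exact mul_ne_zero (ha i₀) (pow_ne_zero 3 hN0)
  · rw [hY]
    push_cast
    simp only [hX', mul_pow, Function.comp_apply, Pi.map_apply, f]
    rw [div_eq_div_iff (ha' i₀) (mul_ne_zero (ha' i₀) (pow_ne_zero 3 hNp)),
      Finset.sum_mul, Finset.sum_mul]
    refine Finset.sum_congr rfl fun i _ => ?_
    ring
end
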